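/- arXiv:1503.04482 — 3 statements merged into one kernel-verified Lean document; each statement's English description precedes it below -/
import Mathlib

section
/- Let L1 be a real symmetric 5×5 matrix such that the family L(t) := cos(t)·L0 + sin(t)·L1 is isospectral. Then the rank of P_4 = L_+^4 is at most 1; more precisely, there exists a real orthogonal 5×5 matrix U and a real number a ≥ 0 such that U·P_4·U^T is the 5×5 matrix whose upper-left 2×2 block equals a·σ and whose remaining entries are zero. -/
open Matrix Kronecker

noncomputable section

/-- `L0 = diag(√3, 1/√3, 0, -1/√3, -√3)`. -/
def L0d : Matrix (Fin 5) (Fin 5) ℝ :=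
  Matrix.diagonal ![Real.sqrt 3, 1 / Real.sqrt 3, 0, -(1 / Real.sqrt 3), -Real.sqrt 3]

/-- The family `L(t) = cos(t)·L0 + sin(t)·L1` is isospectral: for every `t` the matrix
`L(t)` has eigenvalues exactly `-√3, -1/√3, 0, 1/√3, √3`, each with multiplicity one,
i.e. its characteristic polynomial is `X·(X² - 3)·(X² - 1/3)`. -/
def Isospectral (L1 : Matrix (Fin 5) (Fin 5) ℝ) : Prop :=
  ∀ t : ℝ, (Real.cos t • L0d + Real.sin t • L1).charpoly =
    Polynomial.X * (Polynomial.X ^ 2 - Polynomial.C 3) *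
      (Polynomial.X ^ 2 - Polynomial.C (1 / 3 : ℝ))

/-- `L₊ = ½(L0 - i·L1)`, viewed as a complex matrix. -/
def LplusF (L1 : Matrix (Fin 5) (Fin 5) ℝ) : Matrix (Fin 5) (Fin 5) ℂ :=
  (1 / 2 : ℂ) • (L0d.map Complex.ofReal - Complex.I • L1.map Complex.ofReal)

/-- `E`: the real subspace of `ℝ⁵` spanned by the kernels `ker L(t)`, `t ∈ ℝ`. -/
def Espan (L1 : Matrix (Fin 5) (Fin 5) ℝ) : Submodule ℝ (Fin 5 → ℝ) :=
  ⨆ t : ℝ, LinearMap.ker (Real.cos t • L0d + Real.sin t • L1).mulVecLin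

/-- The isotropic vector `e₊ = (e₁ + i·e₂)/√2` of `ℂ²`, as a `2 × 1` column matrix. -/
def ePlus : Matrix (Fin 2) (Fin 1) ℂ :=
  !![1 / (Real.sqrt 2 : ℂ); Complex.I / (Real.sqrt 2 : ℂ)]

/-- `σ = e₊·e₊ᵀ = ½·[[1, i], [i, -1]] ∈ M₂(ℂ)`. -/
def sigmaC : Matrix (Fin 2) (Fin 2) ℂ := ePlus * ePlusᵀ

/-- The canonical identification `Fin 2 ⊕ Fin 3 ≃ Fin 5`. -/
def eq235 : Fin 2 ⊕ Fin 3 ≃ Fin 5 := finSumFinEquiv.trans (finCongr (by norm_num))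

/-- The powers of a nilpotent endomorphism lose rank at every step. -/
theorem finrank_range_pow_le_of_isNilpotent {K V : Type*} [Field K] [AddCommGroup V] [Module K V]
    [FiniteDimensional K V] {f : Module.End K V} (hf : IsNilpotent f) (k : ℕ) :
    Module.finrank K (LinearMap.range (f ^ k)) ≤ Module.finrank K V - k := by
  induction k with
  | zero => simpa using Submodule.finrank_le _
  | succ k ih =>
    have hle : LinearMap.range (f ^ (k + 1)) ≤ LinearMap.range (f ^ k) := by
      rw [pow_succ]
      exact LinearMap.range_comp_le_range _ _
    rcases hle.lt_or_eq with hlt | heq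
    · have := Submodule.finrank_lt_finrank_of_lt hlt
      omega
    · have hstable (m : ℕ) : LinearMap.range (f ^ (k + m)) = LinearMap.range (f ^ k) := by
        induction m with
        | zero => rfl
        | succ m hm =>
          rw [← add_assoc, pow_succ', Module.End.mul_eq_comp, LinearMap.range_comp, hm,
            ← LinearMap.range_comp, ← Module.End.mul_eq_comp, ← pow_succ', heq]
      obtain ⟨n, hn⟩ := hf
      have hzero : LinearMap.range (f ^ (k + 1)) = ⊥ := by
        rw [heq, ← hstable n, pow_add, hn, mul_zero, LinearMap.range_zero]
      rw [hzero, finrank_bot]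
      exact Nat.zero_le _

theorem rank_pow_le_of_isNilpotent {K n : Type*} [Field K] [Fintype n] [DecidableEq n]
    {A : Matrix n n K} (hA : IsNilpotent A) (k : ℕ) :
    (A ^ k).rank ≤ Fintype.card n - k := by
  have h := finrank_range_pow_le_of_isNilpotent (hA.map (Matrix.toLinAlgEquiv' (R := K) (n := n))) k
  rw [← map_pow, Module.finrank_fintype_fun_eq_card] at h
  exact h

/-- A symmetric matrix of rank at most one over an algebraically closed field is `v * vᵀ`. -/
theorem exists_eq_vecMulVec_self_of_isSymm {K n : Type*} [Field K] [IsAlgClosed K]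
    [Fintype n] [DecidableEq n] {A : Matrix n n K} (hA : A.IsSymm) (hr : A.rank ≤ 1) :
    ∃ v : n → K, A = vecMulVec v v := by
  obtain ⟨w, hw⟩ := finrank_le_one_iff.mp hr
  have hcol (j : n) : ∃ c : K, ∀ i, A i j = c * (w : n → K) i := by
    obtain ⟨c, hc⟩ := hw ⟨A.mulVecLin (Pi.single j 1), LinearMap.mem_range_self _ _⟩
    refine ⟨c, fun i ↦ ?_⟩
    have := congrFun (congrArg Subtype.val hc) i
    simpa using this.symm
  choose c hc using hcol
  have hsymm (i j : n) : A i j = A j i := hA.apply j i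
  have hminor (i j k l : n) : A i j * A k l = A i l * A k j := by
    rw [hc, hc, hc, hc]
    ring
  by_cases hdiag : ∀ i, A i i = 0
  · refine ⟨0, ?_⟩
    ext i j
    have h := hminor i j j i
    rw [hdiag, hsymm j i, zero_mul, mul_self_eq_zero] at h
    simpa [vecMulVec_apply] using h
  · push Not at hdiag
    obtain ⟨k, hk⟩ := hdiag
    obtain ⟨s, hs⟩ := IsAlgClosed.exists_pow_nat_eq (A k k) (n := 2) two_pos
    have hs0 : s ≠ 0 := by
      rintro rfl
      exact hk (by simpa using hs.symm)
    refine ⟨fun i ↦ A i k / s, ?_⟩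
    ext i j
    have h := hminor i j k k
    rw [hsymm k j] at h
    rw [vecMulVec_apply]
    field_simp
    rw [hs, h]

theorem dotProduct_self_eq_zero_of_vecMulVec_mul_self {K n : Type*} [Field K] [Fintype n]
    {v : n → K} (h : vecMulVec v v * vecMulVec v v = 0) : v ⬝ᵥ v = 0 := by
  by_cases hv : v = 0
  · simp [hv]
  · obtain ⟨i, hi⟩ := Function.ne_iff.mp hv
    have hii := congrFun (congrFun h i) i
    rw [vecMulVec_mul_vecMulVec] at hii
    simpa [vecMulVec_apply, show v i ≠ 0 from hi] using hii

/-- A complex isotropic vector is rotated by a real orthogonal matrix to a nonnegative multiple of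
`e₁ + i e₂`. -/
theorem exists_orthogonal_mulVec_of_isotropic {v : Fin 5 → ℂ} (hv : v ⬝ᵥ v = 0) :
    ∃ (U : Matrix (Fin 5) (Fin 5) ℝ) (r : ℝ), U * Uᵀ = 1 ∧
      U.map Complex.ofReal *ᵥ v = (r : ℂ) • ![1, Complex.I, 0, 0, 0] := by
  set x : EuclideanSpace ℝ (Fin 5) := WithLp.toLp 2 fun i ↦ (v i).re with hx
  set y : EuclideanSpace ℝ (Fin 5) := WithLp.toLp 2 fun i ↦ (v i).im with hy
  have hre : inner ℝ x x = inner ℝ y y := by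
    have := congrArg Complex.re hv
    simp only [dotProduct, Complex.re_sum, Complex.mul_re, Finset.sum_sub_distrib,
      Complex.zero_re, sub_eq_zero] at this
    simpa only [PiLp.inner_apply, hx, hy, RCLike.inner_apply, conj_trivial] using this
  have him : inner ℝ x y = 0 := by
    have := congrArg Complex.im hv
    simp only [dotProduct, Complex.im_sum, Complex.mul_im, Finset.sum_add_distrib,
      Complex.zero_im] at this
    simp only [PiLp.inner_apply, hx, hy, RCLike.inner_apply, conj_trivial]
    simp only [mul_comm (Complex.im _)] at this ⊢
    linarith
  have hnorm : ‖x‖ = ‖y‖ := by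
    rw [real_inner_self_eq_norm_sq, real_inner_self_eq_norm_sq] at hre
    exact (sq_eq_sq₀ (norm_nonneg _) (norm_nonneg _)).mp hre
  by_cases hx0 : ‖x‖ = 0
  · refine ⟨1, 0, by simp, ?_⟩
    have hxz : x = 0 := norm_eq_zero.mp hx0
    have hyz : y = 0 := norm_eq_zero.mp (hnorm ▸ hx0)
    have hvz : v = 0 := by
      ext i
      apply Complex.ext
      · simpa [hx] using congrArg (fun z : EuclideanSpace ℝ (Fin 5) ↦ z i) hxz
      · simpa [hy] using congrArg (fun z : EuclideanSpace ℝ (Fin 5) ↦ z i) hyz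
    simp [hvz]
  set w : Fin 5 → EuclideanSpace ℝ (Fin 5) := ![‖x‖⁻¹ • x, ‖x‖⁻¹ • y, 0, 0, 0] with hw
  have hon : Orthonormal ℝ (({0, 1} : Set (Fin 5)).domRestrict w) := by
    constructor
    · rintro ⟨i, rfl | rfl⟩
      · simp [hw, norm_smul, hx0]
      · simp [hw, norm_smul, ← hnorm, hx0]
    · rintro ⟨i, rfl | rfl⟩ ⟨j, rfl | rfl⟩ hij
      · exact absurd rfl hij
      · simp [hw, inner_smul_left, inner_smul_right, him]
      · simp [hw, inner_smul_left, inner_smul_right, real_inner_comm, him]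
      · exact absurd rfl hij
  obtain ⟨b, hb⟩ := hon.exists_orthonormalBasis_extension_of_card_eq (by simp)
  have hbx : x = ‖x‖ • b 0 := by
    rw [hb 0 (by simp)]
    simp [hw, smul_smul, hx0]
  have hby : y = ‖x‖ • b 1 := by
    rw [hb 1 (by simp)]
    simp [hw, smul_smul, hx0]
  have hbb (i j : Fin 5) : ∑ k, b i k * b j k = if i = j then 1 else 0 := by
    rw [← b.inner_eq_ite i j, real_inner_comm, PiLp.inner_apply]
    simp
  have hvk (k : Fin 5) : v k = (‖x‖ : ℂ) * ((b 0 k : ℝ) + (b 1 k : ℝ) * Complex.I) := by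
    have h1 : (v k).re = ‖x‖ * b 0 k := congrArg (fun z : EuclideanSpace ℝ (Fin 5) ↦ z k) hbx
    have h2 : (v k).im = ‖x‖ * b 1 k := congrArg (fun z : EuclideanSpace ℝ (Fin 5) ↦ z k) hby
    rw [← Complex.re_add_im (v k), h1, h2]
    push_cast
    ring
  refine ⟨Matrix.of fun i k ↦ b i k, ‖x‖, ?_, ?_⟩
  · ext i j
    simp [Matrix.mul_apply, hbb, Matrix.one_apply]
  · ext i
    have hi : (Matrix.map (Matrix.of fun i k ↦ b i k) Complex.ofReal *ᵥ v) i =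
        (‖x‖ : ℂ) * (((∑ k, b i k * b 0 k : ℝ) : ℂ) +
          ((∑ k, b i k * b 1 k : ℝ) : ℂ) * Complex.I) := by
      simp only [mulVec, dotProduct, hvk, Matrix.map_apply, Matrix.of_apply]
      push_cast
      rw [Finset.sum_mul, ← Finset.sum_add_distrib, Finset.mul_sum]
      refine Finset.sum_congr rfl fun k _ ↦ ?_
      ring
    rw [hi, hbb, hbb]
    fin_cases i <;> simp

open Polynomial in
/-- The characteristic polynomial of `L0 + y L1`, by homogeneity. -/
theorem Isospectral.charpoly_add_smul {L1 : Matrix (Fin 5) (Fin 5) ℝ} (h : Isospectral L1)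
    (y : ℝ) : (L0d + y • L1).charpoly =
      X * (X ^ 2 - C (3 * (1 + y ^ 2))) * (X ^ 2 - C (1 / 3 * (1 + y ^ 2))) := by
  refine Polynomial.funext fun z ↦ ?_
  set r := √(1 + y ^ 2) with hr
  have hr0 : r ≠ 0 := by positivity
  have hr2 : 1 + y ^ 2 = r ^ 2 := (Real.sq_sqrt (by positivity)).symm
  have hz := congrArg (eval (z / r)) (h (Real.arctan y))
  rw [Matrix.eval_charpoly, Real.cos_arctan, Real.sin_arctan, ← hr] at hz
  have hscale : Matrix.scalar (Fin 5) z - (L0d + y • L1) =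
      r • (Matrix.scalar (Fin 5) (z / r) - ((1 / r) • L0d + (y / r) • L1)) := by
    ext i j
    by_cases hij : i = j
    · simp [hij]
      field_simp
    · simp [hij]
      field_simp
  rw [Matrix.eval_charpoly, hscale, Matrix.det_smul, hz, hr2]
  simp
  field_simp

open Polynomial in
theorem Isospectral.LplusF_pow_five {L1 : Matrix (Fin 5) (Fin 5) ℝ} (h : Isospectral L1) :
    LplusF L1 ^ 5 = 0 := by
  set M : Matrix (Fin 5) (Fin 5) ℝ[X] := L0d.map (C : ℝ →+* ℝ[X]) + (X : ℝ[X]) • L1.map (C : ℝ →+* ℝ[X]) with hM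
  have hchar : M.charpoly =
      X * (X ^ 2 - C (C 3 * (1 + X ^ 2))) * (X ^ 2 - C (C (1 / 3) * (1 + X ^ 2))) := by
    ext1 n
    refine Polynomial.funext fun y ↦ ?_
    have hmap : M.map (evalRingHom y) = L0d + y • L1 := by
      ext i j
      simp [hM]
      ring
    have hy := congrArg (fun p : ℝ[X] ↦ p.coeff n) (h.charpoly_add_smul y)
    simp only [← hmap, Matrix.charpoly_map, coeff_map] at hy
    rw [← coe_evalRingHom, hy, ← coeff_map]
    simp
  have hmap : M.map (eval₂RingHom Complex.ofRealHom (-Complex.I)) =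
      L0d.map Complex.ofReal - Complex.I • L1.map Complex.ofReal := by
    ext i j
    simp [hM, sub_eq_add_neg]
    ring
  have hX : (M.charpoly).map (eval₂RingHom Complex.ofRealHom (-Complex.I)) = X ^ 5 := by
    rw [hchar]
    simp only [Polynomial.map_mul, Polynomial.map_sub, Polynomial.map_pow, map_X, map_C]
    simp
    ring
  have hpow := Matrix.aeval_self_charpoly
    (M.map (eval₂RingHom Complex.ofRealHom (-Complex.I)))
  rw [Matrix.charpoly_map, hX, hmap, aeval_X_pow] at hpow
  rw [LplusF, _root_.smul_pow, hpow, smul_zero]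

theorem sigmaC_eq : sigmaC = !![1 / 2, Complex.I / 2; Complex.I / 2, -(1 / 2)] := by
  have h2 : ((√2 : ℝ) : ℂ)⁻¹ * ((√2 : ℝ) : ℂ)⁻¹ = 1 / 2 := by
    rw [← mul_inv, ← Complex.ofReal_mul, Real.mul_self_sqrt zero_le_two]
    norm_num
  ext i j
  fin_cases i <;> fin_cases j <;> simp [sigmaC, ePlus, Matrix.mul_apply, div_eq_mul_inv] <;>
    grind [Complex.I_mul_I]

/-- if `L(t) = cos(t)·L0 + sin(t)·L1` is isospectral, then
`rank P₄ ≤ 1` where `P₄ = L₊⁴`; more precisely there are a real orthogonal `U` and a real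
`a ≥ 0` with `U·P₄·Uᵀ` equal to the matrix whose upper-left `2 × 2` block is `a·σ` and
whose remaining entries vanish. -/
theorem statement9 (L1 : Matrix (Fin 5) (Fin 5) ℝ) (hsymm : L1.IsSymm)
    (hiso : Isospectral L1) :
    (LplusF L1 ^ 4).rank ≤ 1 ∧
    ∃ (U : Matrix (Fin 5) (Fin 5) ℝ) (a : ℝ),
      U * Uᵀ = 1 ∧ 0 ≤ a ∧
      U.map Complex.ofReal * LplusF L1 ^ 4 * (U.map Complex.ofReal)ᵀ =
        Matrix.reindex eq235 eq235
          (Matrix.fromBlocks ((a : ℂ) • sigmaC) 0 0 (0 : Matrix (Fin 3) (Fin 3) ℂ)) := by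
  have h5 := hiso.LplusF_pow_five
  have hrank : (LplusF L1 ^ 4).rank ≤ 1 := rank_pow_le_of_isNilpotent ⟨5, h5⟩ 4
  have hL : (LplusF L1).IsSymm := by
    have h0 : L0d.IsSymm := Matrix.isSymm_diagonal _
    exact ((h0.map _).sub ((hsymm.map _).smul _)).smul _
  refine ⟨hrank, ?_⟩
  obtain ⟨v, hv⟩ := exists_eq_vecMulVec_self_of_isSymm (hL.pow 4) hrank
  have hvv : v ⬝ᵥ v = 0 := by
    apply dotProduct_self_eq_zero_of_vecMulVec_mul_self
    rw [← hv, ← pow_add, show 4 + 4 = 5 + 3 from rfl, pow_add, h5, zero_mul]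
  obtain ⟨U, r, hU, hUv⟩ := exists_orthogonal_mulVec_of_isotropic hvv
  refine ⟨U, 2 * r ^ 2, hU, by positivity, ?_⟩
  have h0 : eq235.symm 0 = Sum.inl 0 := rfl
  have h1 : eq235.symm 1 = Sum.inl 1 := rfl
  have h2 : eq235.symm 2 = Sum.inr 0 := rfl
  have h3 : eq235.symm 3 = Sum.inr 1 := rfl
  have h4 : eq235.symm 4 = Sum.inr 2 := rfl
  rw [hv, mul_vecMulVec, vecMulVec_mul, vecMul_transpose, hUv, sigmaC_eq]
  ext i j
  fin_cases i <;> fin_cases j <;>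
    simp [vecMulVec_apply, h0, h1, h2, h3, h4] <;> grind [Complex.I_mul_I]

end
end

section
/- Let L1 be a real symmetric 5×5 matrix such that the family L(t) := cos(t)·L0 + sin(t)·L1 is isospectral, and suppose rank(L_+^4) = 1. Then there exists a real orthogonal 5×5 matrix A such that A·L(t)·A^{−1} = cos(t)·L0 + sin(t)·M for all t ∈ ℝ, where M = (1/(3√3))·[[0,5,0,2,0],[5,0,4,0,2],[0,4,0,4,0],[2,0,4,0,5],[0,2,0,5,0]]. In this case dim E = 3. -/
open Matrix Kronecker

noncomputable section

/-- The first normal form of `L1`. -/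
def M₁ : Matrix (Fin 5) (Fin 5) ℝ :=
  (1 / (3 * Real.sqrt 3)) •
    !![0, 5, 0, 2, 0; 5, 0, 4, 0, 2; 0, 4, 0, 4, 0; 2, 0, 4, 0, 5; 0, 2, 0, 5, 0]

/-- Real symmetric matrices with the same characteristic polynomial are orthogonally conjugate. -/
theorem exists_orthogonal_conj_of_charpoly_eq {n : Type*} [Fintype n] [DecidableEq n]
    {A B : Matrix n n ℝ} (hA : A.IsSymm) (hB : B.IsSymm) (h : A.charpoly = B.charpoly) :
    ∃ W : Matrix n n ℝ, W * Wᵀ = 1 ∧ A = W * B * Wᵀ := by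
  have hA' : A.IsHermitian := by rwa [Matrix.IsHermitian, conjTranspose_eq_transpose_of_trivial]
  have hB' : B.IsHermitian := by rwa [Matrix.IsHermitian, conjTranspose_eq_transpose_of_trivial]
  have hev := (hA'.eigenvalues_eq_eigenvalues_iff hB').2 h
  have h1 := hA'.spectral_theorem
  have h2 := hB'.conjStarAlgAut_star_eigenvectorUnitary
  rw [hev, ← h2, Unitary.conjStarAlgAut_apply, Unitary.conjStarAlgAut_star_apply] at h1
  set U : Matrix n n ℝ := (hA'.eigenvectorUnitary : Matrix n n ℝ)
  set V : Matrix n n ℝ := (hB'.eigenvectorUnitary : Matrix n n ℝ)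
  have hU : U * Uᵀ = 1 := by
    have : U * star U = 1 := Unitary.coe_mul_star_self hA'.eigenvectorUnitary
    rwa [star_eq_conjTranspose, conjTranspose_eq_transpose_of_trivial] at this
  have hV : Vᵀ * V = 1 := by
    have : star V * V = 1 := Unitary.coe_star_mul_self hB'.eigenvectorUnitary
    rwa [star_eq_conjTranspose, conjTranspose_eq_transpose_of_trivial] at this
  rw [star_eq_conjTranspose, star_eq_conjTranspose, conjTranspose_eq_transpose_of_trivial,
    conjTranspose_eq_transpose_of_trivial] at h1
  refine ⟨U * Vᵀ, ?_, ?_⟩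
  · rw [transpose_mul, transpose_transpose, Matrix.mul_assoc, ← Matrix.mul_assoc Vᵀ, hV,
      Matrix.one_mul, hU]
  · rw [transpose_mul, transpose_transpose]
    simpa only [Matrix.mul_assoc] using h1

/-- Three orthonormal vectors are the first three rows of an orthogonal `5 × 5` matrix. -/
theorem exists_orthogonal_extension {e₀ e₁ e₂ : Fin 5 → ℝ}
    (h00 : e₀ ⬝ᵥ e₀ = 1) (h11 : e₁ ⬝ᵥ e₁ = 1) (h22 : e₂ ⬝ᵥ e₂ = 1)
    (h01 : e₀ ⬝ᵥ e₁ = 0) (h02 : e₀ ⬝ᵥ e₂ = 0) (h12 : e₁ ⬝ᵥ e₂ = 0) :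
    ∃ O : Matrix (Fin 5) (Fin 5) ℝ, O * Oᵀ = 1 ∧ O 0 = e₀ ∧ O 1 = e₁ ∧ O 2 = e₂ := by
  let v : Fin 5 → EuclideanSpace ℝ (Fin 5) :=
    ![WithLp.toLp 2 e₀, WithLp.toLp 2 e₁, WithLp.toLp 2 e₂, 0, 0]
  have hv : Orthonormal ℝ (({0, 1, 2} : Set (Fin 5)).domRestrict v) := by
    rw [orthonormal_iff_ite]
    rintro ⟨i, hi⟩ ⟨j, hj⟩
    simp only [Set.mem_insert_iff, Set.mem_singleton_iff] at hi hj
    have h10 := h01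
    have h20 := h02
    have h21 := h12
    rw [dotProduct_comm] at h10 h20 h21
    rcases hi with rfl | rfl | rfl <;> rcases hj with rfl | rfl | rfl <;>
      rw [EuclideanSpace.inner_eq_star_dotProduct] <;> simp [v, *]
  obtain ⟨b, hb⟩ := hv.exists_orthonormalBasis_extension_of_card_eq (by simp)
  refine ⟨Matrix.of fun i j => b i j, ?_, ?_, ?_, ?_⟩
  · ext i j
    have := (orthonormal_iff_ite.1 b.orthonormal) j i
    rw [EuclideanSpace.inner_eq_star_dotProduct] at this
    rw [Matrix.mul_apply, Matrix.one_apply]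
    simpa [dotProduct, eq_comm] using this
  · ext j; simp [hb 0 (by simp), v]
  · ext j; simp [hb 1 (by simp), v]
  · ext j; simp [hb 2 (by simp), v]

open Polynomial in
/-- A symmetric matrix of real polynomials with vanishing `2 × 2` minors and without common complex
zero of its entries is of the form `q qᵀ`, once a diagonal entry takes the value `1` at `0`. -/
theorem exists_eq_mul_of_rank_one {n : Type*} {R : n → n → ℝ[X]}
    (hR : ∀ i j, R i j = R j i) (hmin : ∀ i j k l, R i j * R k l = R i l * R k j)
    (i₀ : n) (h0 : (R i₀ i₀).eval 0 = 1) (hz : ∀ z : ℂ, ∃ i j, aeval z (R i j) ≠ 0) :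
    ∃ q : n → ℝ[X], ∀ i j, R i j = q i * q j := by
  have hρ0 : R i₀ i₀ ≠ 0 := fun h => by simp [h] at h0
  obtain ⟨h, g, hg, hhg⟩ : ∃ h g : ℝ[X], Squarefree g ∧ R i₀ i₀ = h ^ 2 * g := by
    classical
    have : ∀ (d : ℕ) (ρ : ℝ[X]), ρ ≠ 0 → ρ.natDegree ≤ d →
        ∃ h g : ℝ[X], Squarefree g ∧ ρ = h ^ 2 * g := by
      intro d
      induction d using Nat.strong_induction_on with
      | _ d ih =>
        intro ρ hρ hd
        by_cases hs : Squarefree ρ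
        · exact ⟨1, ρ, hs, by simp⟩
        · rw [Squarefree] at hs
          push Not at hs
          obtain ⟨x, ⟨y, hy⟩, hx⟩ := hs
          have hx0 : x ≠ 0 := by rintro rfl; simp at hy; exact hρ hy
          have hy0 : y ≠ 0 := by rintro rfl; simp at hy; exact hρ hy
          have hdx : x.natDegree ≠ 0 := fun hc => hx <| by
            rw [Polynomial.isUnit_iff_degree_eq_zero, Polynomial.degree_eq_natDegree hx0, hc]; rfl
          have hdy : ρ.natDegree = x.natDegree + x.natDegree + y.natDegree := by
            rw [hy, natDegree_mul (mul_ne_zero hx0 hx0) hy0, natDegree_mul hx0 hx0]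
          obtain ⟨h, g, hg, e⟩ := ih y.natDegree (by omega) y hy0 le_rfl
          exact ⟨x * h, g, hg, by rw [hy, e]; ring⟩
    exact this _ _ hρ0 le_rfl
  have hh0 : h ≠ 0 := by rintro rfl; simp at hhg; exact hρ0 hhg
  have hdvd : ∀ i, h ∣ R i₀ i := fun i => by
    rw [← IsIntegrallyClosed.pow_dvd_pow_iff two_ne_zero, sq (R i₀ i)]
    nth_rewrite 2 [hR]
    rw [← hmin i₀ i₀ i i, hhg]
    exact ⟨g * R i i, by ring⟩
  choose q hq using hdvd
  have hgq : ∀ i j, g * R i j = q i * q j := fun i j => by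
    have h1 := hmin i₀ i₀ i j
    rw [hR i i₀, hhg, hq i, hq j] at h1
    exact mul_left_cancel₀ (pow_ne_zero 2 hh0) (by linear_combination h1)
  have hunit : IsUnit g := by
    by_contra hgu
    obtain ⟨π, hπ, hπg⟩ := WfDvdMonoid.exists_irreducible_factor hgu hg.ne_zero
    have hπR : ∀ i j, π ∣ R i j := fun i j => by
      have hqi : ∀ i, π ∣ q i := fun i => by
        have : π ∣ q i * q i := by rw [← hgq]; exact hπg.mul_right _
        exact (hπ.prime.dvd_or_dvd this).elim id id
      obtain ⟨g', hg'⟩ := hπg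
      have h1 : π * π ∣ π * (g' * R i j) := by
        rw [← mul_assoc, ← hg', hgq]; exact mul_dvd_mul (hqi i) (hqi j)
      have h2 := (mul_dvd_mul_iff_left hπ.ne_zero).1 h1
      refine (hπ.prime.dvd_or_dvd h2).resolve_left fun h3 => hπ.not_isUnit (hg π ?_)
      rw [hg']; exact mul_dvd_mul_left _ h3
    obtain ⟨z, hz'⟩ := Complex.exists_root (f := π.map (algebraMap ℝ ℂ))
      (by rw [degree_map]; exact degree_pos_of_irreducible hπ)
    obtain ⟨i, j, hij⟩ := hz z
    refine hij ?_
    obtain ⟨y, hy⟩ := hπR i j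
    rw [hy, map_mul, aeval_def, ← eval_map, hz'.eq_zero, zero_mul]
  obtain ⟨c, hc, rfl⟩ := Polynomial.isUnit_iff.1 hunit
  have hcpos : 0 < c := by
    have h1 := hhg ▸ h0
    simp only [eval_mul, eval_pow, eval_C] at h1
    by_contra hn
    nlinarith [sq_nonneg (eval 0 h)]
  have hs : Real.sqrt c * Real.sqrt c = c := Real.mul_self_sqrt hcpos.le
  have hs0 : Real.sqrt c ≠ 0 := (Real.sqrt_pos.2 hcpos).ne'
  refine ⟨fun i => C (Real.sqrt c)⁻¹ * q i, fun i j => ?_⟩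
  have h1 : C c⁻¹ * C c = (1 : ℝ[X]) := by rw [← C_mul, inv_mul_cancel₀ hcpos.ne', C_1]
  have h2 : C (Real.sqrt c)⁻¹ * C (Real.sqrt c)⁻¹ = (C c⁻¹ : ℝ[X]) := by
    rw [← C_mul, ← mul_inv, hs]
  linear_combination (-(R i j)) * h1 + C c⁻¹ * hgq i j - q i * q j * h2

/-- The matrix pencil `L0 + X L1` with polynomial entries. -/
def pencil (L1 : Matrix (Fin 5) (Fin 5) ℝ) : Matrix (Fin 5) (Fin 5) (Polynomial ℝ) :=
  L0d.map Polynomial.C + (Polynomial.X : Polynomial ℝ) • L1.map Polynomial.C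

/-- For isospectral `L1`, the value at `tan t` is a multiple of the projection to `ker L(t)`. -/
def kerProj (L1 : Matrix (Fin 5) (Fin 5) ℝ) : Matrix (Fin 5) (Fin 5) (Polynomial ℝ) :=
  pencil L1 ^ 4 - (Polynomial.C (10 / 3) * (1 + Polynomial.X ^ 2) : Polynomial ℝ) • pencil L1 ^ 2 +
    ((1 + Polynomial.X ^ 2) ^ 2 : Polynomial ℝ) • 1

theorem kerProj_map {S : Type*} [CommRing S] [Algebra ℝ S] (f : Polynomial ℝ →ₐ[ℝ] S)
    (L1 : Matrix (Fin 5) (Fin 5) ℝ) :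
    f.mapMatrix (kerProj L1) =
      (L0d.map (algebraMap ℝ S) + f Polynomial.X • L1.map (algebraMap ℝ S)) ^ 4 -
        (algebraMap ℝ S (10 / 3) * (1 + f Polynomial.X ^ 2)) •
          (L0d.map (algebraMap ℝ S) + f Polynomial.X • L1.map (algebraMap ℝ S)) ^ 2 +
        ((1 + f Polynomial.X ^ 2) ^ 2) • 1 := by
  have hsmul : ∀ (a : Polynomial ℝ) (B : Matrix (Fin 5) (Fin 5) (Polynomial ℝ)),
      f.mapMatrix (a • B) = f a • f.mapMatrix B := fun a B => by ext i j; simp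
  have hC : ∀ B : Matrix (Fin 5) (Fin 5) ℝ,
      f.mapMatrix (B.map Polynomial.C) = B.map (algebraMap ℝ S) := fun B => by
    ext i j
    simp only [AlgHom.mapMatrix_apply, Matrix.map_apply]
    exact f.commutes _
  have hp : f.mapMatrix (pencil L1) =
      L0d.map (algebraMap ℝ S) + f Polynomial.X • L1.map (algebraMap ℝ S) := by
    rw [pencil, map_add, hsmul, hC, hC]
  rw [kerProj, map_add, map_sub, map_pow, hsmul, hsmul, map_pow, hp, map_one, map_mul, map_pow,
    map_add, map_one, map_pow]
  congr 4
  exact f.commutes _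

theorem isSymm_L0d : L0d.IsSymm := by simp [L0d, Matrix.IsSymm]

theorem Isospectral.exists_conj {L1 : Matrix (Fin 5) (Fin 5) ℝ} (hsymm : L1.IsSymm)
    (hiso : Isospectral L1) {c s : ℝ} (hcs : c ^ 2 + s ^ 2 = 1) :
    ∃ W : Matrix (Fin 5) (Fin 5) ℝ, W * Wᵀ = 1 ∧ c • L0d + s • L1 = W * L0d * Wᵀ := by
  obtain ⟨t, rfl, rfl⟩ : ∃ t : ℝ, c = Real.cos t ∧ s = Real.sin t := by
    have hn : ‖(⟨c, s⟩ : ℂ)‖ = 1 := by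
      rw [Complex.norm_eq_sqrt_sq_add_sq]; simp [hcs]
    have h0 : (⟨c, s⟩ : ℂ) ≠ 0 := fun h => by simp [h] at hn
    refine ⟨Complex.arg ⟨c, s⟩, ?_, ?_⟩
    · rw [Complex.cos_arg h0, hn]; simp
    · rw [Complex.sin_arg, hn]; simp
  refine exists_orthogonal_conj_of_charpoly_eq ?_ isSymm_L0d ?_
  · simp [Matrix.IsSymm, isSymm_L0d.eq, hsymm.eq]
  · have h0 := hiso 0
    simp only [Real.cos_zero, Real.sin_zero, one_smul, zero_smul, add_zero] at h0
    rw [hiso t, h0]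

theorem orthogonal_conj_pow {n : Type*} [Fintype n] [DecidableEq n] {W : Matrix n n ℝ}
    (hW : W * Wᵀ = 1) (B : Matrix n n ℝ) (k : ℕ) :
    (W * B * Wᵀ) ^ k = W * B ^ k * Wᵀ := by
  have hW' : Wᵀ * W = 1 := mul_eq_one_comm.1 hW
  induction k with
  | zero => simp [hW]
  | succ k ih =>
    rw [pow_succ, ih, pow_succ]
    calc W * B ^ k * Wᵀ * (W * B * Wᵀ) = W * B ^ k * (Wᵀ * W) * B * Wᵀ := by
          simp only [Matrix.mul_assoc]
      _ = _ := by rw [hW']; simp only [Matrix.mul_assoc, Matrix.mul_one]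

theorem L0d_quartic : L0d ^ 4 - (10 / 3 : ℝ) • L0d ^ 2 + 1 =
    vecMulVec (Pi.single 2 1) (Pi.single 2 1) := by
  have h3 : Real.sqrt 3 ^ 2 = 3 := Real.sq_sqrt (by norm_num)
  have h4 : ∀ x : ℝ, x ^ 4 = (x ^ 2) ^ 2 := fun x => by ring
  rw [L0d, diagonal_pow, diagonal_pow]
  ext i j
  fin_cases i <;> fin_cases j <;>
    simp [vecMulVec_apply, h3, h4] <;> norm_num

/-- A unit vector spanning the kernel of `c L0 + s L1`. -/
theorem Isospectral.exists_kernel {L1 : Matrix (Fin 5) (Fin 5) ℝ} (hsymm : L1.IsSymm)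
    (hiso : Isospectral L1) {c s : ℝ} (hcs : c ^ 2 + s ^ 2 = 1) :
    ∃ w : Fin 5 → ℝ, w ⬝ᵥ w = 1 ∧ (c • L0d + s • L1) *ᵥ w = 0 ∧
      (c • L0d + s • L1) ^ 4 - (10 / 3 : ℝ) • (c • L0d + s • L1) ^ 2 + 1 = vecMulVec w w := by
  obtain ⟨W, hW, hL⟩ := hiso.exists_conj hsymm hcs
  have hW' : Wᵀ * W = 1 := mul_eq_one_comm.1 hW
  refine ⟨W *ᵥ Pi.single 2 1, ?_, ?_, ?_⟩
  · rw [dotProduct_mulVec, vecMul_mulVec, hW', vecMul_one]; simp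
  · rw [hL, mulVec_mulVec, Matrix.mul_assoc, hW', Matrix.mul_one, ← mulVec_mulVec, L0d]
    have : diagonal ![Real.sqrt 3, 1 / Real.sqrt 3, 0, -(1 / Real.sqrt 3), -Real.sqrt 3] *ᵥ
        Pi.single 2 1 = 0 := by
      rw [diagonal_mulVec_single]; simp
    rw [this, mulVec_zero]
  · rw [hL, orthogonal_conj_pow hW, orthogonal_conj_pow hW]
    have : W * L0d ^ 4 * Wᵀ - (10 / 3 : ℝ) • (W * L0d ^ 2 * Wᵀ) + 1 =
        W * (L0d ^ 4 - (10 / 3 : ℝ) • L0d ^ 2 + 1) * Wᵀ := by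
      rw [Matrix.mul_add, Matrix.add_mul, Matrix.mul_sub, Matrix.sub_mul, Matrix.mul_smul,
        Matrix.smul_mul, Matrix.mul_one, hW]
    rw [this, L0d_quartic, mul_vecMulVec, vecMulVec_mul, vecMul_transpose]

theorem Isospectral.eq_smul_of_kernel {L1 : Matrix (Fin 5) (Fin 5) ℝ} (hsymm : L1.IsSymm)
    (hiso : Isospectral L1) {c s : ℝ} (hcs : c ^ 2 + s ^ 2 = 1) {x y : Fin 5 → ℝ} (hx : x ⬝ᵥ x ≠ 0)
    (hLx : (c • L0d + s • L1) *ᵥ x = 0) (hLy : (c • L0d + s • L1) *ᵥ y = 0) :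
    ∃ a : ℝ, y = a • x := by
  obtain ⟨w, -, -, hw⟩ := hiso.exists_kernel hsymm hcs
  have key : ∀ v, (c • L0d + s • L1) *ᵥ v = 0 → v = (w ⬝ᵥ v) • w := fun v hv => by
    have h := congrArg (· *ᵥ v) hw
    simpa [add_mulVec, sub_mulVec, smul_mulVec, pow_succ, ← mulVec_mulVec, hv,
      vecMulVec_mulVec] using h
  have hwx : w ⬝ᵥ x ≠ 0 := fun h => hx <| by
    have := key x hLx
    rw [h, zero_smul] at this
    simp [this]
  refine ⟨(w ⬝ᵥ y) / (w ⬝ᵥ x), ?_⟩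
  nth_rewrite 2 [key x hLx]
  rw [smul_smul, div_mul_cancel₀ _ hwx, ← key y hLy]

theorem Isospectral.kerProj_eval {L1 : Matrix (Fin 5) (Fin 5) ℝ} (hsymm : L1.IsSymm)
    (hiso : Isospectral L1) (s : ℝ) :
    ∃ w : Fin 5 → ℝ, w ⬝ᵥ w = 1 ∧ (L0d + s • L1) *ᵥ w = 0 ∧
      ∀ i j, (kerProj L1 i j).eval s = (1 + s ^ 2) ^ 2 * (w i * w j) := by
  have hpos : 0 < 1 + s ^ 2 := by positivity
  set r := Real.sqrt (1 + s ^ 2) with hr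
  have hr2 : r ^ 2 = 1 + s ^ 2 := Real.sq_sqrt hpos.le
  have hr0 : r ≠ 0 := (Real.sqrt_pos.2 hpos).ne'
  obtain ⟨w, hw, hLw, h4⟩ := hiso.exists_kernel hsymm (c := r⁻¹) (s := r⁻¹ * s) (by
    field_simp; linarith)
  have hK : r⁻¹ • L0d + (r⁻¹ * s) • L1 = r⁻¹ • (L0d + s • L1) := by rw [smul_add, smul_smul]
  rw [hK] at hLw h4
  refine ⟨w, hw, ?_, fun i j => ?_⟩
  · rw [smul_mulVec] at hLw
    exact (smul_eq_zero.1 hLw).resolve_left (inv_ne_zero hr0)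
  · have h1 := congrFun (congrFun (kerProj_map (Polynomial.aeval s) L1) i) j
    have h2 := congrFun (congrFun h4 i) j
    simp only [AlgHom.mapMatrix_apply, Matrix.map_apply, Polynomial.coe_aeval_eq_eval,
      Polynomial.aeval_X] at h1
    rw [h1]
    have hid : ∀ B : Matrix (Fin 5) (Fin 5) ℝ, B.map (algebraMap ℝ ℝ) = B := fun B => by
      ext; simp
    rw [hid, hid]
    simp only [smul_pow, Matrix.add_apply, Matrix.sub_apply, Matrix.smul_apply, smul_eq_mul,
      vecMulVec_apply, Algebra.algebraMap_self, RingHom.id_apply] at h2 ⊢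
    rw [← h2, ← hr2]
    field_simp

theorem natDegree_mul_apply_le {n : Type*} [Fintype n] {A B : Matrix n n (Polynomial ℝ)} {a b : ℕ}
    (hA : ∀ i j, (A i j).natDegree ≤ a) (hB : ∀ i j, (B i j).natDegree ≤ b) (i j : n) :
    ((A * B) i j).natDegree ≤ a + b := by
  rw [Matrix.mul_apply]
  exact Polynomial.natDegree_sum_le_of_forall_le _ _ fun k _ =>
    Polynomial.natDegree_mul_le_of_le (hA i k) (hB k j)

theorem natDegree_kerProj_le (L1 : Matrix (Fin 5) (Fin 5) ℝ) (i j : Fin 5) :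
    (kerProj L1 i j).natDegree ≤ 4 := by
  have h1 : ∀ i j, (pencil L1 i j).natDegree ≤ 1 := fun i j => by
    simp only [pencil, Matrix.add_apply, Matrix.smul_apply, Matrix.map_apply, smul_eq_mul]
    compute_degree
  have h2 : ∀ i j, ((pencil L1 ^ 2) i j).natDegree ≤ 2 := by
    rw [sq]; exact natDegree_mul_apply_le h1 h1
  have h4 : ∀ i j, ((pencil L1 ^ 4) i j).natDegree ≤ 4 := by
    rw [show 4 = 2 + 2 from rfl, pow_add]; exact natDegree_mul_apply_le h2 h2
  rw [kerProj, Matrix.add_apply, Matrix.sub_apply, Matrix.smul_apply, Matrix.smul_apply,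
    smul_eq_mul, smul_eq_mul]
  refine Polynomial.natDegree_add_le_of_degree_le 
    (Polynomial.natDegree_sub_le_of_le (n := 4) (h4 i j) ?_ |>.trans (by simp)) ?_
  · refine Polynomial.natDegree_mul_le_of_le (m := 2) (n := 2) ?_ (h2 i j)
    compute_degree
  · refine Polynomial.natDegree_mul_le_of_le (m := 4) (n := 0) ?_ ?_
    · compute_degree
    · rw [Matrix.one_apply]; split_ifs <;> simp

theorem kerProj_aeval_neg_I (L1 : Matrix (Fin 5) (Fin 5) ℝ) :
    (Polynomial.aeval (-Complex.I)).mapMatrix (kerProj L1) = (16 : ℂ) • LplusF L1 ^ 4 := by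
  have h : L0d.map (algebraMap ℝ ℂ) + (-Complex.I) • L1.map (algebraMap ℝ ℂ) =
      (2 : ℂ) • LplusF L1 := by
    rw [LplusF, smul_smul, neg_smul, ← sub_eq_add_neg]
    norm_num
  rw [kerProj_map, Polynomial.aeval_X, h, smul_pow]
  norm_num

theorem Isospectral.exists_aeval_ne_zero {L1 : Matrix (Fin 5) (Fin 5) ℝ} (hsymm : L1.IsSymm)
    (hiso : Isospectral L1) (hrk : LplusF L1 ^ 4 ≠ 0) (z : ℂ) :
    ∃ i j, Polynomial.aeval z (kerProj L1 i j) ≠ 0 := by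
  by_contra! hz
  have hneg : ∃ i j, Polynomial.aeval (-Complex.I) (kerProj L1 i j) ≠ 0 := by
    by_contra! h
    apply hrk
    have h1 := kerProj_aeval_neg_I L1
    have h2 : (Polynomial.aeval (-Complex.I)).mapMatrix (kerProj L1) = 0 := by
      ext i j; simp [h]
    rw [h2] at h1
    exact (smul_eq_zero.1 h1.symm).resolve_left (by norm_num)
  have htr : ∑ i, kerProj L1 i i = (1 + Polynomial.X ^ 2) ^ 2 := Polynomial.funext fun s => by
    obtain ⟨w, hw, -, h⟩ := hiso.kerProj_eval hsymm s
    rw [Polynomial.eval_finsetSum]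
    simp only [h, ← Finset.mul_sum]
    rw [dotProduct] at hw
    simp [hw]
  have hz2 : (1 + z ^ 2) ^ 2 = 0 := by
    have := congrArg (Polynomial.aeval z) htr
    rw [map_sum] at this
    simpa [hz] using this.symm
  have hfac : (z - Complex.I) * (z - -Complex.I) = 0 := by
    linear_combination (pow_eq_zero_iff two_ne_zero).1 hz2 - Complex.I_sq
  obtain ⟨i, j, hij⟩ := hneg
  apply hij
  rcases mul_eq_zero.1 hfac with h | h
  · have hI : -Complex.I = (starRingEnd ℂ) z := by rw [sub_eq_zero.1 h]; simp
    rw [hI, Polynomial.aeval_conj, hz, map_zero]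
  · rw [← sub_eq_zero.1 h, hz]

theorem cubic_coeffs_eq_zero {a b c d : ℝ}
    (h : ∀ s : ℝ, a + s * b + s ^ 2 * c + s ^ 3 * d = 0) : a = 0 ∧ b = 0 ∧ c = 0 ∧ d = 0 := by
  have h0 := h 0
  have h1 := h 1
  have h2 := h (-1)
  have h3 := h 2
  norm_num at h0 h1 h2 h3
  refine ⟨?_, ?_, ?_, ?_⟩ <;> linarith

/-- The kernel of `L(t)` is spanned by a quadratic form in `(cos t, sin t)`. -/
theorem Isospectral.exists_kernel_polynomial {L1 : Matrix (Fin 5) (Fin 5) ℝ} (hsymm : L1.IsSymm)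
    (hiso : Isospectral L1) (hrk : LplusF L1 ^ 4 ≠ 0) :
    ∃ q₀ q₁ q₂ : Fin 5 → ℝ, L0d *ᵥ q₀ = 0 ∧ L0d *ᵥ q₁ + L1 *ᵥ q₀ = 0 ∧
      L0d *ᵥ q₂ + L1 *ᵥ q₁ = 0 ∧ L1 *ᵥ q₂ = 0 ∧ q₀ ⬝ᵥ q₀ = 1 ∧ q₀ ⬝ᵥ q₁ = 0 ∧
      q₁ ⬝ᵥ q₁ + 2 * (q₀ ⬝ᵥ q₂) = 2 ∧ q₁ ⬝ᵥ q₂ = 0 ∧ q₂ ⬝ᵥ q₂ = 1 ∧ q₀ ≠ q₂ := by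
  obtain ⟨q, hq⟩ := exists_eq_mul_of_rank_one (R := kerProj L1)
    (fun i j => Polynomial.funext fun s => by
      obtain ⟨w, -, -, h⟩ := hiso.kerProj_eval hsymm s
      rw [h, h]; ring)
    (fun i j k l => Polynomial.funext fun s => by
      obtain ⟨w, -, -, h⟩ := hiso.kerProj_eval hsymm s
      simp only [Polynomial.eval_mul, h]; ring) 2
    (by
      have h1 := congrFun (congrFun (kerProj_map (Polynomial.aeval (0 : ℝ)) L1) 2) 2
      have h2 := congrFun (congrFun L0d_quartic 2) 2
      have hid : L0d.map (algebraMap ℝ ℝ) = L0d := by ext; simp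
      rw [hid] at h1
      simp only [AlgHom.mapMatrix_apply, Matrix.map_apply, Polynomial.coe_aeval_eq_eval,
        Polynomial.aeval_X, zero_smul, add_zero] at h1
      rw [h1]
      simpa [vecMulVec_apply] using h2)
    (hiso.exists_aeval_ne_zero hsymm hrk)
  have hdeg : ∀ i, (q i).natDegree ≤ 2 := fun i => by
    have h1 := natDegree_kerProj_le L1 i i
    rw [hq, ← sq, Polynomial.natDegree_pow] at h1
    omega
  set Q : ℕ → Fin 5 → ℝ := fun k i => (q i).coeff k with hQ
  have hexp : ∀ i, q i = Polynomial.C (Q 0 i) + Polynomial.C (Q 1 i) * Polynomial.X +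
      Polynomial.C (Q 2 i) * Polynomial.X ^ 2 := fun i => by
    conv_lhs => rw [(q i).as_sum_range_C_mul_X_pow' (n := 3) (by have := hdeg i; omega)]
    simp [Finset.sum_range_succ, hQ]
  have heval : ∀ s i, (q i).eval s = Q 0 i + s * Q 1 i + s ^ 2 * Q 2 i := fun s i => by
    rw [hexp]; simp; ring
  have hv : ∀ s : ℝ, (Q 0 + s • Q 1 + s ^ 2 • Q 2) ⬝ᵥ (Q 0 + s • Q 1 + s ^ 2 • Q 2) =
      (1 + s ^ 2) ^ 2 ∧ (L0d + s • L1) *ᵥ (Q 0 + s • Q 1 + s ^ 2 • Q 2) = 0 := fun s => by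
    have hvq : Q 0 + s • Q 1 + s ^ 2 • Q 2 = fun i => (q i).eval s := by
      ext i; rw [heval]; simp
    obtain ⟨w, hw, hLw, h⟩ := hiso.kerProj_eval hsymm s
    have hqq : ∀ i j, (q i).eval s * (q j).eval s = (1 + s ^ 2) ^ 2 * (w i * w j) := fun i j => by
      rw [← h, hq, Polynomial.eval_mul]
    have hnorm : (fun i => (q i).eval s) ⬝ᵥ (fun i => (q i).eval s) = (1 + s ^ 2) ^ 2 := by
      simp only [dotProduct, hqq] at hw ⊢
      rw [← Finset.mul_sum, hw, mul_one]
    rw [hvq]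
    refine ⟨hnorm, ?_⟩
    have hne : (1 + s ^ 2) ^ 2 ≠ 0 := by positivity
    have hmul : (fun i => (q i).eval s) = ((fun i => (q i).eval s) ⬝ᵥ w) • w := by
      ext i
      refine mul_left_cancel₀ hne ?_
      conv_lhs => rw [← hnorm]
      simp only [dotProduct, Pi.smul_apply, smul_eq_mul, Finset.sum_mul, Finset.mul_sum]
      refine Finset.sum_congr rfl fun j _ => ?_
      linear_combination (q j).eval s * hqq i j
    rw [hmul, mulVec_smul, hLw, smul_zero]
  have hlin : ∀ i, (L0d *ᵥ Q 0) i = 0 ∧ (L0d *ᵥ Q 1 + L1 *ᵥ Q 0) i = 0 ∧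
      (L0d *ᵥ Q 2 + L1 *ᵥ Q 1) i = 0 ∧ (L1 *ᵥ Q 2) i = 0 := fun i =>
    cubic_coeffs_eq_zero fun s => by
      have h := congrFun (hv s).2 i
      simp only [add_mulVec, mulVec_add, mulVec_smul, smul_mulVec, Pi.add_apply, Pi.smul_apply,
        smul_eq_mul, Pi.zero_apply] at h ⊢
      linear_combination h
  have hquad : ∀ s : ℝ, Q 0 ⬝ᵥ Q 0 + 2 * s * (Q 0 ⬝ᵥ Q 1) + s ^ 2 * (Q 1 ⬝ᵥ Q 1 +
      2 * (Q 0 ⬝ᵥ Q 2)) + 2 * s ^ 3 * (Q 1 ⬝ᵥ Q 2) + s ^ 4 * (Q 2 ⬝ᵥ Q 2) = (1 + s ^ 2) ^ 2 :=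
    fun s => by
      have h := (hv s).1
      simp only [add_dotProduct, dotProduct_add, smul_dotProduct, dotProduct_smul, smul_eq_mul,
        dotProduct_comm (Q 1) (Q 0), dotProduct_comm (Q 2) (Q 0), dotProduct_comm (Q 2) (Q 1)] at h
      linear_combination h
  have e0 := hquad 0
  have e1 := hquad 1
  have e2 := hquad (-1)
  have e3 := hquad 2
  have e4 := hquad (-2)
  norm_num at e0 e1 e2 e3 e4
  have hq11 : Q 1 ⬝ᵥ Q 1 + 2 * (Q 0 ⬝ᵥ Q 2) = 2 := by linarith
  have hq22 : Q 2 ⬝ᵥ Q 2 = 1 := by linarith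
  refine ⟨Q 0, Q 1, Q 2, funext fun i => (hlin i).1, funext fun i => (hlin i).2.1,
    funext fun i => (hlin i).2.2.1, funext fun i => (hlin i).2.2.2, e0, by linarith, hq11,
    by linarith, hq22, fun h02 => ?_⟩
  have hq1 : Q 1 = 0 := by
    rw [h02, hq22] at hq11
    exact dotProduct_self_eq_zero.1 (by linarith)
  obtain ⟨i, j, hij⟩ := hiso.exists_aeval_ne_zero hsymm hrk Complex.I
  apply hij
  rw [hq, hexp i, hq1, h02]
  simp

/-- An orthonormal frame of the span of the kernels, adapted to the pair `L0, L1`. -/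
theorem Isospectral.exists_frame {L1 : Matrix (Fin 5) (Fin 5) ℝ} (hsymm : L1.IsSymm)
    (hiso : Isospectral L1) (hrk : LplusF L1 ^ 4 ≠ 0) :
    ∃ (γ : ℝ) (e₀ e₁ e₂ : Fin 5 → ℝ), 0 < γ ∧ e₀ ⬝ᵥ e₀ = 1 ∧ e₁ ⬝ᵥ e₁ = 1 ∧ e₂ ⬝ᵥ e₂ = 1 ∧
      e₀ ⬝ᵥ e₁ = 0 ∧ e₀ ⬝ᵥ e₂ = 0 ∧ e₁ ⬝ᵥ e₂ = 0 ∧ L0d *ᵥ e₁ = -(L1 *ᵥ e₀) ∧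
      L1 *ᵥ e₁ = L0d *ᵥ e₀ ∧ L0d *ᵥ e₂ = -(γ • L0d *ᵥ e₀) ∧ L1 *ᵥ e₂ = γ • L1 *ᵥ e₀ := by
  obtain ⟨q₀, q₁, q₂, h0, h1, h2, h3, n00, n01, n11, n12, n22, hne⟩ :=
    hiso.exists_kernel_polynomial hsymm hrk
  have n10 : q₁ ⬝ᵥ q₀ = 0 := by rw [dotProduct_comm, n01]
  have n21 : q₂ ⬝ᵥ q₁ = 0 := by rw [dotProduct_comm, n12]
  have n20 : q₂ ⬝ᵥ q₀ = q₀ ⬝ᵥ q₂ := dotProduct_comm _ _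
  set κ := q₀ ⬝ᵥ q₂ with hκ
  have hsub : (q₀ - q₂) ⬝ᵥ (q₀ - q₂) = 2 - 2 * κ := by
    simp only [sub_dotProduct, dotProduct_sub, n00, n22, n20]; ring
  have hadd : (q₀ + q₂) ⬝ᵥ (q₀ + q₂) = 2 + 2 * κ := by
    simp only [add_dotProduct, dotProduct_add, n00, n22, n20]; ring
  have hα : 0 < (1 - κ) / 2 := by
    have h4 : 0 ≤ (q₀ - q₂) ⬝ᵥ (q₀ - q₂) := by
      simpa using dotProduct_star_self_nonneg (q₀ - q₂)
    have h5 : (q₀ - q₂) ⬝ᵥ (q₀ - q₂) ≠ 0 := fun h =>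
      hne (sub_eq_zero.1 (dotProduct_self_eq_zero.1 h))
    have := lt_of_le_of_ne h4 h5.symm
    linarith
  have hβ : 0 < (1 + κ) / 2 := by
    have h4 : 0 ≤ (q₀ + q₂) ⬝ᵥ (q₀ + q₂) := by
      simpa using dotProduct_star_self_nonneg (q₀ + q₂)
    have h5 : (q₀ + q₂) ⬝ᵥ (q₀ + q₂) ≠ 0 := fun h => by
      have h6 : q₂ = -q₀ := by
        rw [eq_neg_iff_add_eq_zero, add_comm]; exact dotProduct_self_eq_zero.1 h
      have h7 : L1 *ᵥ q₀ = 0 := by simpa [h6, mulVec_neg] using h3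
      rw [h7, add_zero] at h1
      obtain ⟨a, ha⟩ := hiso.eq_smul_of_kernel hsymm (c := 1) (s := 0) (x := q₀) (y := q₁)
        (by norm_num) (by rw [n00]; norm_num) (by simpa using h0) (by simpa using h1)
      have h8 : a = 0 := by
        rw [ha, dotProduct_smul, n00, smul_eq_mul, mul_one] at n01; exact n01
      rw [ha, h8, zero_smul, zero_dotProduct] at n11
      rw [hadd] at h
      linarith
    have := lt_of_le_of_ne h4 h5.symm
    linarith
  set α := Real.sqrt ((1 - κ) / 2) with hαdef
  set β := Real.sqrt ((1 + κ) / 2) with hβdef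
  have hα2 : α ^ 2 = (1 - κ) / 2 := Real.sq_sqrt hα.le
  have hβ2 : β ^ 2 = (1 + κ) / 2 := Real.sq_sqrt hβ.le
  have hα0 : 0 < α := Real.sqrt_pos.2 hα
  have hβ0 : 0 < β := Real.sqrt_pos.2 hβ
  have hL0q2 : L0d *ᵥ q₂ = -(L1 *ᵥ q₁) := eq_neg_of_add_eq_zero_left h2
  have hL1q0 : L1 *ᵥ q₀ = -(L0d *ᵥ q₁) := eq_neg_of_add_eq_zero_right h1
  refine ⟨α / β, (2 * α)⁻¹ • (q₀ - q₂), (2 * α)⁻¹ • q₁, (2 * β)⁻¹ • (q₀ + q₂),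
    div_pos hα0 hβ0, ?_, ?_, ?_, ?_, ?_, ?_, ?_, ?_, ?_, ?_⟩
  · simp only [smul_dotProduct, dotProduct_smul, hsub, smul_eq_mul]
    field_simp; linarith
  · have : q₁ ⬝ᵥ q₁ = 2 - 2 * κ := by linarith
    simp only [smul_dotProduct, dotProduct_smul, this, smul_eq_mul]
    field_simp; linarith
  · simp only [smul_dotProduct, dotProduct_smul, hadd, smul_eq_mul]
    field_simp; linarith
  · simp [smul_dotProduct, dotProduct_smul, sub_dotProduct, n01, n21]
  · simp [smul_dotProduct, dotProduct_smul, sub_dotProduct, dotProduct_add, n00, n20, n22, ← hκ]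
    ring
  · simp [smul_dotProduct, dotProduct_smul, dotProduct_add, n10, n12]
  · simp [mulVec_smul, mulVec_sub, hL1q0, h3]
  · simp [mulVec_smul, mulVec_sub, h0, hL0q2]
  · simp only [mulVec_smul, mulVec_sub, mulVec_add, h0, smul_smul, zero_add, zero_sub, smul_neg,
      neg_neg]
    congr 1; field_simp
  · simp only [mulVec_smul, mulVec_sub, mulVec_add, h3, smul_smul, add_zero, sub_zero]
    congr 1; field_simp

theorem finrank_Espan_of_frame {L1 : Matrix (Fin 5) (Fin 5) ℝ} (hsymm : L1.IsSymm)
    (hiso : Isospectral L1) {γ : ℝ} {e₀ e₁ e₂ : Fin 5 → ℝ} (hγ : 0 < γ)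
    (h00 : e₀ ⬝ᵥ e₀ = 1) (h11 : e₁ ⬝ᵥ e₁ = 1) (h22 : e₂ ⬝ᵥ e₂ = 1)
    (h01 : e₀ ⬝ᵥ e₁ = 0) (h02 : e₀ ⬝ᵥ e₂ = 0) (h12 : e₁ ⬝ᵥ e₂ = 0)
    (hA : L0d *ᵥ e₁ = -(L1 *ᵥ e₀)) (hB : L1 *ᵥ e₁ = L0d *ᵥ e₀)
    (hC : L0d *ᵥ e₂ = -(γ • L0d *ᵥ e₀)) (hD : L1 *ᵥ e₂ = γ • L1 *ᵥ e₀) :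
    Module.finrank ℝ (Espan L1) = 3 := by
  have h10 : e₁ ⬝ᵥ e₀ = 0 := by rw [dotProduct_comm, h01]
  have h20 : e₂ ⬝ᵥ e₀ = 0 := by rw [dotProduct_comm, h02]
  have h21 : e₂ ⬝ᵥ e₁ = 0 := by rw [dotProduct_comm, h12]
  have hli : LinearIndependent ℝ ![e₀, e₁, e₂] := by
    rw [Fintype.linearIndependent_iff]
    intro g hg
    rw [Fin.sum_univ_three] at hg
    simp only [Matrix.cons_val] at hg
    have k0 := congrArg (e₀ ⬝ᵥ ·) hg
    have k1 := congrArg (e₁ ⬝ᵥ ·) hg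
    have k2 := congrArg (e₂ ⬝ᵥ ·) hg
    simp only [dotProduct_add, dotProduct_smul, h00, h11, h22, h01, h02, h12, h10, h20, h21,
      dotProduct_zero, smul_eq_mul, mul_one, mul_zero, add_zero, zero_add] at k0 k1 k2
    intro i
    fin_cases i <;> assumption
  have hker : ∀ c s : ℝ, c ^ 2 + s ^ 2 = 1 → (c • L0d + s • L1) *ᵥ
      ((γ * (c ^ 2 - s ^ 2)) • e₀ + (2 * c * s * γ) • e₁ + e₂) = 0 := fun c s hcs => by
    ext i
    simp only [add_mulVec, mulVec_add, smul_mulVec, mulVec_smul, hA, hB, hC, hD, Pi.add_apply,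
      Pi.smul_apply, Pi.neg_apply, smul_eq_mul, Pi.zero_apply]
    linear_combination (γ * c * (L0d *ᵥ e₀) i - γ * s * (L1 *ᵥ e₀) i) * hcs
  have hE : Espan L1 = Submodule.span ℝ (Set.range ![e₀, e₁, e₂]) := by
    have hm : ∀ i, ![e₀, e₁, e₂] i ∈ Submodule.span ℝ (Set.range ![e₀, e₁, e₂]) := fun i =>
      Submodule.subset_span ⟨i, rfl⟩
    apply le_antisymm
    · refine iSup_le fun t y hy => ?_
      obtain ⟨a, rfl⟩ := hiso.eq_smul_of_kernel hsymm (Real.cos_sq_add_sin_sq t) (y := y) (by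
          simp only [add_dotProduct, dotProduct_add, smul_dotProduct, dotProduct_smul, h00, h11,
            h22, h01, h02, h12, h10, h20, h21, smul_eq_mul]
          refine ne_of_gt ?_
          nlinarith [sq_nonneg (γ * (Real.cos t ^ 2 - Real.sin t ^ 2)),
            sq_nonneg (2 * Real.cos t * Real.sin t * γ)]) (hker _ _ (Real.cos_sq_add_sin_sq t)) (by
          rwa [LinearMap.mem_ker, mulVecLin_apply] at hy)
      exact Submodule.smul_mem _ _ (Submodule.add_mem _ (Submodule.add_mem _
        (Submodule.smul_mem _ _ (hm 0)) (Submodule.smul_mem _ _ (hm 1))) (hm 2))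
    · have hmem : ∀ t : ℝ, (γ * (Real.cos t ^ 2 - Real.sin t ^ 2)) • e₀ +
          (2 * Real.cos t * Real.sin t * γ) • e₁ + e₂ ∈ Espan L1 := fun t =>
        Submodule.mem_iSup_of_mem t (by
          rw [LinearMap.mem_ker, mulVecLin_apply]
          exact hker _ _ (Real.cos_sq_add_sin_sq t))
      have m0 := hmem 0
      have m1 := hmem (Real.pi / 2)
      have m2 := hmem (Real.pi / 4)
      have hs2 : Real.sqrt 2 ^ 2 = 2 := Real.sq_sqrt (by norm_num)
      have hcs : 2 * Real.cos (Real.pi / 4) * Real.sin (Real.pi / 4) * γ = γ := by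
        rw [Real.cos_pi_div_four, Real.sin_pi_div_four]
        linear_combination γ / 2 * hs2
      rw [hcs, Real.cos_pi_div_four, Real.sin_pi_div_four] at m2
      simp only [Real.cos_zero, Real.sin_zero, Real.cos_pi_div_two, Real.sin_pi_div_two, sub_self,
        mul_zero, zero_mul, zero_smul, zero_add, add_zero] at m0 m1 m2
      norm_num at m0 m1
      have k2 : e₂ ∈ Espan L1 := by
        have : e₂ = (1 / 2 : ℝ) • ((γ • e₀ + e₂) + (-(γ • e₀) + e₂)) := by module
        rw [this]
        exact Submodule.smul_mem _ _ (Submodule.add_mem _ m0 m1)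
      have hγ' : ∀ v : Fin 5 → ℝ, γ • v + e₂ ∈ Espan L1 → v ∈ Espan L1 := fun v hv => by
        have h := Submodule.smul_mem _ γ⁻¹ (Submodule.sub_mem _ hv k2)
        rwa [add_sub_cancel_right, inv_smul_smul₀ hγ.ne'] at h
      rw [Submodule.span_le]
      rintro _ ⟨i, rfl⟩
      fin_cases i
      · exact hγ' _ m0
      · exact hγ' _ m2
      · exact k2
  rw [hE, finrank_span_eq_card hli, Fintype.card_fin]

/-- Symmetric matrices vanishing on a three-dimensional coordinate subspace. -/
def blockMat (a b c : Fin 2 → ℝ) (m n k : ℝ) : Matrix (Fin 5) (Fin 5) ℝ :=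
  !![0, 0, 0, a 0, a 1; 0, 0, 0, b 0, b 1; 0, 0, 0, c 0, c 1;
    a 0, b 0, c 0, m, n; a 1, b 1, c 1, n, k]

theorem trace_blockMat_sq (a b c : Fin 2 → ℝ) (m n : ℝ) :
    (blockMat a b c m n (-m) ^ 2).trace = 2 * (a 0 ^ 2 + b 0 ^ 2 + c 0 ^ 2 + a 1 ^ 2 + b 1 ^ 2 +
      c 1 ^ 2) + 2 * (m ^ 2 + n ^ 2) := by
  simp [blockMat, Matrix.trace, Fin.sum_univ_five, sq]
  ring

theorem trace_blockMat_cube (a b c : Fin 2 → ℝ) (m n : ℝ) :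
    (blockMat a b c m n (-m) ^ 3).trace = 3 * (m * (a 0 ^ 2 + b 0 ^ 2 + c 0 ^ 2 -
      (a 1 ^ 2 + b 1 ^ 2 + c 1 ^ 2)) + 2 * n * (a 0 * a 1 + b 0 * b 1 + c 0 * c 1)) := by
  simp [blockMat, Matrix.trace, Fin.sum_univ_five, pow_succ]
  ring

theorem trace_blockMat_fourth (a b c : Fin 2 → ℝ) (m n : ℝ) :
    (blockMat a b c m n (-m) ^ 4).trace = 2 * ((a 0 ^ 2 + b 0 ^ 2 + c 0 ^ 2) ^ 2 +
      2 * (a 0 * a 1 + b 0 * b 1 + c 0 * c 1) ^ 2 + (a 1 ^ 2 + b 1 ^ 2 + c 1 ^ 2) ^ 2) +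
      4 * (m ^ 2 + n ^ 2) * (a 0 ^ 2 + b 0 ^ 2 + c 0 ^ 2 + a 1 ^ 2 + b 1 ^ 2 + c 1 ^ 2) +
      2 * (m ^ 2 + n ^ 2) ^ 2 := by
  rw [show 4 = 2 + 2 from rfl, pow_add, sq]
  simp [blockMat, Matrix.trace, Fin.sum_univ_five]
  ring

theorem trace_orthogonal_conj {n : Type*} [Fintype n] [DecidableEq n] {W : Matrix n n ℝ}
    (hW : W * Wᵀ = 1) (B : Matrix n n ℝ) (k : ℕ) :
    ((W * B * Wᵀ) ^ k).trace = (B ^ k).trace := by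
  rw [orthogonal_conj_pow hW, Matrix.trace_mul_comm, ← Matrix.mul_assoc, mul_eq_one_comm.1 hW,
    Matrix.one_mul]

theorem trace_L0d_pow : L0d.trace = 0 ∧ (L0d ^ 2).trace = 20 / 3 ∧ (L0d ^ 3).trace = 0 ∧
    (L0d ^ 4).trace = 164 / 9 := by
  have h2 : Real.sqrt 3 ^ 2 = 3 := Real.sq_sqrt (by norm_num)
  have h3 : ∀ x : ℝ, x ^ 3 = x ^ 2 * x := fun x => by ring
  have h4 : ∀ x : ℝ, x ^ 4 = (x ^ 2) ^ 2 := fun x => by ring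
  rw [L0d, diagonal_pow, diagonal_pow, diagonal_pow]
  refine ⟨?_, ?_, ?_, ?_⟩ <;>
    simp [Matrix.trace_diagonal, Fin.sum_univ_five, h2, h3, h4] <;> norm_num

/-- The algebraic core: vanishing of the `2 × 2` block, written with complex parameters. -/
theorem block_eq_zero {w w' r s : ℂ} {G : ℝ} (hG : 0 < G)
    (h1 : r * star s = -(G * star w * w')) (h2 : r * star w ^ 2 + star s * w' ^ 2 = 0)
    (h3 : (1 + 2 * G) * r * star w * star w' + G * s * star w ^ 2 + G * star r * w' ^ 2 +
      (1 + 2 * G) * star s * w * w' = 0)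
    (h4 : w * star w - w' * star w' ≠ 0) : r = 0 ∧ s = 0 := by
  have hG' : (G : ℂ) ≠ 0 := by exact_mod_cast hG.ne'
  by_cases hw : w = 0
  · subst hw
    have hw' : w' ≠ 0 := by rintro rfl; simp at h4
    simp only [star_zero] at h2 h3
    have hs : s = 0 := by simpa [hw'] using h2
    subst hs
    exact ⟨by simpa [hw', hG'] using h3, rfl⟩
  by_cases hw' : w' = 0
  · subst hw'
    have hr : r = 0 := by simpa [hw] using h2
    subst hr
    exact ⟨rfl, by simpa [hw, hG'] using h3⟩
  exfalso
  have hws : star w ≠ 0 := by simpa using hw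
  have h2' : star r * w ^ 2 + s * star w' ^ 2 = 0 := by
    simpa using congrArg star h2
  have hB : star s ^ 2 * w' = G * star w ^ 3 := by
    refine mul_right_cancel₀ hw' ?_
    linear_combination star s * h2 - star w ^ 2 * h1
  have h5 : (1 + 2 * G) * star s * w' * w ^ 2 + G * star w * s * (w * star w + w' * star w') = 0 := by
    refine (mul_eq_zero.1 (?_ : (w * star w - w' * star w') * _ = 0)).resolve_left h4
    linear_combination w ^ 2 * star w * h3 - (1 + 2 * G) * star w' * w ^ 2 * h2 -
      G * star w * w' ^ 2 * h2'
  have h6 : (1 + 2 * G) * (w * star w) ^ 2 + s * star s * (w * star w + w' * star w') = 0 := by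
    refine (mul_eq_zero.1 (?_ : (G * star w) * _ = 0)).resolve_left (mul_ne_zero hG' hws)
    linear_combination star s * h5 - (1 + 2 * G) * w ^ 2 * hB
  have h7 : (1 + 2 * G) * (Complex.normSq w) ^ 2 +
      Complex.normSq s * (Complex.normSq w + Complex.normSq w') = 0 := by
    have := h6
    simp only [Complex.star_def, Complex.mul_conj] at this
    exact_mod_cast this
  have h8 := Complex.normSq_pos.2 hw
  have h9 := Complex.normSq_nonneg s
  have h10 := Complex.normSq_nonneg w'
  have : 0 < (1 + 2 * G) * (Complex.normSq w) ^ 2 := by positivity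
  have : 0 ≤ Complex.normSq s * (Complex.normSq w + Complex.normSq w') := by positivity
  linarith

set_option maxHeartbeats 1000000 in
theorem block_solution {γ d e f g : ℝ} {x y : Fin 2 → ℝ} (hγ : 0 < γ)
    (ht : ∀ c s : ℝ, c ^ 2 + s ^ 2 = 1 → ∀ B : Matrix (Fin 5) (Fin 5) ℝ,
      B = blockMat (c • x + s • y) (-(c • y) + s • x) (-((c * γ) • x) + (s * γ) • y)
        (c * d + s * f) (c * e + s * g) (-(c * d + s * f)) →
      (B ^ 2).trace = 20 / 3 ∧ (B ^ 3).trace = 0 ∧ (B ^ 4).trace = 164 / 9) :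
    d = 0 ∧ e = 0 ∧ f = 0 ∧ g = 0 ∧ x 0 ^ 2 + x 1 ^ 2 = 1 / 3 ∧ y 0 ^ 2 + y 1 ^ 2 = 1 / 3 ∧
      x 0 * y 0 + x 1 * y 1 = 0 ∧ γ = 2 * Real.sqrt 2 := by
  have T2 : ∀ c s : ℝ, c ^ 2 + s ^ 2 = 1 → _ := fun c s h => (ht c s h _ rfl).1
  have T3 : ∀ c s : ℝ, c ^ 2 + s ^ 2 = 1 → _ := fun c s h => (ht c s h _ rfl).2.1
  have T4 := (ht 1 0 (by norm_num) _ rfl).2.2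
  simp only [trace_blockMat_sq, trace_blockMat_cube, trace_blockMat_fourth, Pi.add_apply,
    Pi.neg_apply, Pi.smul_apply, smul_eq_mul] at T2 T3 T4
  generalize x 0 = x₁ at *
  generalize x 1 = x₂ at *
  generalize y 0 = y₁ at *
  generalize y 1 = y₂ at *
  clear ht
  have a1 := T2 1 0 (by norm_num)
  have a2 := T2 0 1 (by norm_num)
  have a3 := T2 (3 / 5) (4 / 5) (by norm_num)
  have b1 := T3 1 0 (by norm_num)
  have b2 := T3 0 1 (by norm_num)
  have b3 := T3 (3 / 5) (4 / 5) (by norm_num)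
  have b4 := T3 (3 / 5) (-(4 / 5)) (by norm_num)
  clear T2 T3
  have E11 : d * f + e * g = γ ^ 2 * (x₁ * y₁ + x₂ * y₂) := by
    linear_combination (25 / 48) * (a3 - (9 / 25) * a1 - (16 / 25) * a2)
  have Ed : d ^ 2 + e ^ 2 - f ^ 2 - g ^ 2 + γ ^ 2 * (x₁ ^ 2 + x₂ ^ 2 - y₁ ^ 2 - y₂ ^ 2) = 0 := by
    linear_combination (1 / 2) * (a1 - a2)
  have k30 : d * (x₁ ^ 2 + y₁ ^ 2 - x₂ ^ 2 - y₂ ^ 2 + γ ^ 2 * (x₁ ^ 2 - x₂ ^ 2)) +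
      2 * e * (x₁ * x₂ + y₁ * y₂ + γ ^ 2 * x₁ * x₂) = 0 := by
    linear_combination (1 / 3) * b1
  have k03 : f * (x₁ ^ 2 + y₁ ^ 2 - x₂ ^ 2 - y₂ ^ 2 + γ ^ 2 * (y₁ ^ 2 - y₂ ^ 2)) +
      2 * g * (x₁ * x₂ + y₁ * y₂ + γ ^ 2 * y₁ * y₂) = 0 := by
    linear_combination (1 / 3) * b2
  have k21 : f * (x₁ ^ 2 + y₁ ^ 2 - x₂ ^ 2 - y₂ ^ 2 + γ ^ 2 * (x₁ ^ 2 - x₂ ^ 2)) +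
      2 * g * (x₁ * x₂ + y₁ * y₂ + γ ^ 2 * x₁ * x₂) - 2 * γ ^ 2 * d * (x₁ * y₁ - x₂ * y₂) -
      2 * γ ^ 2 * e * (x₁ * y₂ + x₂ * y₁) = 0 := by
    linear_combination (125 / 216) * (b3 - b4) - (16 / 27) * b2
  have k12 : d * (x₁ ^ 2 + y₁ ^ 2 - x₂ ^ 2 - y₂ ^ 2 + γ ^ 2 * (y₁ ^ 2 - y₂ ^ 2)) +
      2 * e * (x₁ * x₂ + y₁ * y₂ + γ ^ 2 * y₁ * y₂) - 2 * γ ^ 2 * f * (x₁ * y₁ - x₂ * y₂) -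
      2 * γ ^ 2 * g * (x₁ * y₂ + x₂ * y₁) = 0 := by
    linear_combination (125 / 288) * (b3 + b4) - (3 / 16) * b1
  have hdet : (1 + γ ^ 2) * (x₁ * y₂ - x₂ * y₁) ^ 2 = 1 := by
    linear_combination (1 / 4) * (-T4 + (1 / 2) * (2 * (x₁ ^ 2 + y₁ ^ 2 + γ ^ 2 * x₁ ^ 2 +
      x₂ ^ 2 + y₂ ^ 2 + γ ^ 2 * x₂ ^ 2 + d ^ 2 + e ^ 2) + 20 / 3) * a1)
  have hγ2 : γ ^ 2 ≠ 0 := by positivity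
  have hr : (⟨(d + g) / 2, (e - f) / 2⟩ : ℂ) = 0 ∧ (⟨(d - g) / 2, (e + f) / 2⟩ : ℂ) = 0 := by
    refine block_eq_zero (w := ⟨x₁ + y₂, x₂ - y₁⟩) (w' := ⟨x₁ - y₂, x₂ + y₁⟩) (G := γ ^ 2 / 4)
      (by positivity) ?_ ?_ ?_ ?_
    · apply Complex.ext <;>
        simp only [Complex.star_def, Complex.mul_re, Complex.mul_im, Complex.conj_re,
          Complex.conj_im, Complex.neg_re, Complex.neg_im, Complex.ofReal_re, Complex.ofReal_im]
      · linear_combination (1 / 4) * Ed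
      · linear_combination -(1 / 2) * E11
    · apply Complex.ext <;>
        simp only [Complex.star_def, Complex.mul_re, Complex.mul_im, Complex.conj_re, sq,
          Complex.conj_im, Complex.add_re, Complex.add_im, Complex.zero_re, Complex.zero_im] <;>
        refine (mul_eq_zero.1 (?_ : γ ^ 2 * _ = 0)).resolve_left hγ2
      · linear_combination k30 - k12
      · linear_combination k03 - k21
    · apply Complex.ext <;>
        simp only [Complex.star_def, Complex.mul_re, Complex.mul_im, Complex.conj_re, sq,
          Complex.conj_im, Complex.add_re, Complex.add_im, Complex.zero_re, Complex.zero_im,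
          Complex.ofReal_re, Complex.ofReal_im, Complex.one_re, Complex.one_im, Complex.re_ofNat,
          Complex.im_ofNat]
      · linear_combination (1 / 4) * (3 * k30 + k12)
      · linear_combination -(1 / 4) * (k21 + 3 * k03)
    · intro h
      have h' := congrArg Complex.re h
      simp only [Complex.star_def, Complex.mul_re, Complex.conj_re, Complex.conj_im,
        Complex.sub_re, Complex.zero_re] at h'
      have h0 : x₁ * y₂ - x₂ * y₁ = 0 := by linear_combination (1 / 4) * h'
      rw [h0] at hdet
      norm_num at hdet
  simp only [Complex.ext_iff, Complex.zero_re, Complex.zero_im] at hr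
  obtain ⟨⟨r1, r2⟩, r3, r4⟩ := hr
  obtain rfl : d = 0 := by linarith
  obtain rfl : e = 0 := by linarith
  obtain rfl : f = 0 := by linarith
  obtain rfl : g = 0 := by linarith
  have hxy : x₁ * y₁ + x₂ * y₂ = 0 :=
    (mul_eq_zero.1 (by linear_combination -E11 : γ ^ 2 * _ = 0)).resolve_left hγ2
  have hXY : x₁ ^ 2 + x₂ ^ 2 - y₁ ^ 2 - y₂ ^ 2 = 0 :=
    (mul_eq_zero.1 (by linear_combination Ed : γ ^ 2 * _ = 0)).resolve_left hγ2
  have hX : (x₁ ^ 2 + x₂ ^ 2) * (2 + γ ^ 2) = 10 / 3 := by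
    linear_combination (1 / 2) * a1 + hXY
  have hX2 : (1 + γ ^ 2) * (x₁ ^ 2 + x₂ ^ 2) ^ 2 = 1 := by
    linear_combination hdet + (1 + γ ^ 2) * ((x₁ * y₁ + x₂ * y₂) * hxy + (x₁ ^ 2 + x₂ ^ 2) * hXY)
  have h8 : (γ ^ 2 - 8) * (9 * γ ^ 2 + 8) = 0 := by
    generalize x₁ ^ 2 + x₂ ^ 2 = t at hX hX2
    linear_combination -(9 * (2 + γ ^ 2) ^ 2) * hX2 +
      9 * (1 + γ ^ 2) * (t * (2 + γ ^ 2) + 10 / 3) * hX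
  have hγ8 : γ ^ 2 = 8 := by
    have := (mul_eq_zero.1 h8).resolve_right (by positivity)
    linarith
  rw [hγ8] at hX
  refine ⟨rfl, rfl, rfl, rfl, by linarith, by linarith, hxy, ?_⟩
  have hs2 : Real.sqrt 2 ^ 2 = 2 := Real.sq_sqrt (by norm_num)
  refine (pow_left_inj₀ hγ.le (by positivity) two_ne_zero).1 ?_
  rw [hγ8, mul_pow, hs2]
  norm_num

/-- The identity on the first three coordinates, extended by a `2 × 2` block with rows `p`, `q`. -/
def blockExt (p q : Fin 2 → ℝ) : Matrix (Fin 5) (Fin 5) ℝ :=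
  !![1, 0, 0, 0, 0; 0, 1, 0, 0, 0; 0, 0, 1, 0, 0; 0, 0, 0, p 0, p 1; 0, 0, 0, q 0, q 1]

theorem conj_blockMat (a b c p q : Fin 2 → ℝ) :
    blockExt p q * blockMat a b c 0 0 0 * (blockExt p q)ᵀ =
    blockMat ![a 0 * p 0 + a 1 * p 1, a 0 * q 0 + a 1 * q 1]
      ![b 0 * p 0 + b 1 * p 1, b 0 * q 0 + b 1 * q 1]
      ![c 0 * p 0 + c 1 * p 1, c 0 * q 0 + c 1 * q 1] 0 0 0 := by
  ext i j
  fin_cases i <;> fin_cases j <;>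
    simp [blockExt, blockMat, Matrix.mul_apply, Fin.sum_univ_five] <;> ring

set_option maxHeartbeats 1000000 in
/-- An orthogonal matrix bringing `L0` and `M₁` to block form simultaneously. -/
theorem exists_orthogonal_blockMat :
    ∃ S : Matrix (Fin 5) (Fin 5) ℝ, S * Sᵀ = 1 ∧
      S * L0d * Sᵀ = blockMat ![√3 / 3, 0] ![0, -(√3 / 3)] ![-(2 * √2 * (√3 / 3)), 0] 0 0 0 ∧
      S * M₁ * Sᵀ = blockMat ![0, √3 / 3] ![√3 / 3, 0] ![0, 2 * √2 * (√3 / 3)] 0 0 0 := by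
  have h2 : √2 ^ 2 = (2 : ℝ) := Real.sq_sqrt (by norm_num)
  have h3 : √3 ^ 2 = (3 : ℝ) := Real.sq_sqrt (by norm_num)
  have hi : (√3)⁻¹ = √3 / 3 := by
    rw [inv_eq_iff_eq_inv, inv_div, eq_div_iff (by positivity)]; linarith
  have hL : L0d = √3 • diagonal ![1, 1 / 3, 0, -(1 / 3), -1] := by
    rw [L0d, ← diagonal_smul]
    congr 1
    ext i
    fin_cases i <;> simp [hi] <;> ring
  have hM : M₁ = √3 • (1 / 9 : ℝ) •
      !![0, 5, 0, 2, 0; 5, 0, 4, 0, 2; 0, 4, 0, 4, 0; 2, 0, 4, 0, 5; 0, 2, 0, 5, 0] := by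
    rw [M₁, smul_smul]
    congr 1
    rw [one_div, mul_inv, hi]
    ring
  have hB : ∀ a b c : Fin 2 → ℝ, blockMat (√3 • a) (√3 • b) (√3 • c) 0 0 0 =
      √3 • blockMat a b c 0 0 0 := fun a b c => by
    ext i j
    fin_cases i <;> fin_cases j <;> simp [blockMat]
  have hF0 : blockMat ![√3 / 3, 0] ![0, -(√3 / 3)] ![-(2 * √2 * (√3 / 3)), 0] 0 0 0 =
      √3 • blockMat ![1 / 3, 0] ![0, -(1 / 3)] ![-(2 * √2 / 3), 0] 0 0 0 := by
    rw [← hB]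
    congr 1 <;> ext i <;> fin_cases i <;> simp <;> ring
  have hF1 : blockMat ![0, √3 / 3] ![√3 / 3, 0] ![0, 2 * √2 * (√3 / 3)] 0 0 0 =
      √3 • blockMat ![0, 1 / 3] ![1 / 3, 0] ![0, 2 * √2 / 3] 0 0 0 := by
    rw [← hB]
    congr 1 <;> ext i <;> fin_cases i <;> simp <;> ring
  rw [hL, hM, hF0, hF1]
  generalize √2 = u at *
  refine ⟨!![-(u / 6), 0, 4 * (u / 6), 0, -(u / 6); 0, -(u / 2), 0, u / 2, 0;
    2 / 3, 0, 1 / 3, 0, 2 / 3; -(u / 2), 0, 0, 0, u / 2; 0, u / 2, 0, u / 2, 0], ?_, ?_, ?_⟩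
  · ext i j
    fin_cases i <;> fin_cases j <;>
      simp [Matrix.mul_apply, Fin.sum_univ_five] <;> ring_nf <;> (try simp only [h2]) <;> norm_num
  · rw [Matrix.mul_smul, Matrix.smul_mul]
    congr 1
    ext i j
    fin_cases i <;> fin_cases j <;>
      simp [blockMat, Matrix.mul_apply, vecMul_diagonal, Fin.sum_univ_five] <;> ring_nf <;>
      (try simp only [h2]) <;> norm_num
  · rw [Matrix.mul_smul, Matrix.smul_mul]
    congr 1
    ext i j
    fin_cases i <;> fin_cases j <;>
      simp [blockMat, Matrix.mul_apply, Fin.sum_univ_five] <;> ring_nf <;>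
      (try simp only [h2]) <;> norm_num

theorem conj_apply_eq_dotProduct {n : Type*} [Fintype n] (O L : Matrix n n ℝ) (i j : n) :
    (O * L * Oᵀ) i j = O i ⬝ᵥ (L *ᵥ O j) := by
  rw [Matrix.mul_assoc, Matrix.mul_apply]
  rfl

theorem isSymm_conj {n : Type*} [Fintype n] {L : Matrix n n ℝ} (hL : L.IsSymm) (O : Matrix n n ℝ) :
    (O * L * Oᵀ).IsSymm := by
  rw [Matrix.IsSymm, transpose_mul, transpose_mul, transpose_transpose, hL.eq, Matrix.mul_assoc]

theorem Isospectral.exists_conj_blockMat {L1 : Matrix (Fin 5) (Fin 5) ℝ} (hsymm : L1.IsSymm)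
    (hiso : Isospectral L1) {γ : ℝ} {e₀ e₁ e₂ : Fin 5 → ℝ} (hγ : 0 < γ)
    (h00 : e₀ ⬝ᵥ e₀ = 1) (h11 : e₁ ⬝ᵥ e₁ = 1) (h22 : e₂ ⬝ᵥ e₂ = 1)
    (h01 : e₀ ⬝ᵥ e₁ = 0) (h02 : e₀ ⬝ᵥ e₂ = 0) (h12 : e₁ ⬝ᵥ e₂ = 0)
    (hA : L0d *ᵥ e₁ = -(L1 *ᵥ e₀)) (hB : L1 *ᵥ e₁ = L0d *ᵥ e₀)
    (hC : L0d *ᵥ e₂ = -(γ • L0d *ᵥ e₀)) (hD : L1 *ᵥ e₂ = γ • L1 *ᵥ e₀) :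
    ∃ (O : Matrix (Fin 5) (Fin 5) ℝ) (x y : Fin 2 → ℝ) (d e f g : ℝ), O * Oᵀ = 1 ∧
      O * L0d * Oᵀ = blockMat x (-y) (-(γ • x)) d e (-d) ∧
      O * L1 * Oᵀ = blockMat y x (γ • y) f g (-f) := by
  obtain ⟨O, hO, rfl, rfl, rfl⟩ := exists_orthogonal_extension h00 h11 h22 h01 h02 h12
  have hO' : Oᵀ * O = 1 := mul_eq_one_comm.1 hO
  set P := O * L0d * Oᵀ with hP
  set Q := O * L1 * Oᵀ with hQ
  have hPs : ∀ i j, P i j = P j i := fun i j => (isSymm_conj isSymm_L0d O).apply j i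
  have hQs : ∀ i j, Q i j = Q j i := fun i j => (isSymm_conj hsymm O).apply j i
  have a1 : ∀ i, P i 1 = -Q i 0 := fun i => by
    rw [hP, hQ, conj_apply_eq_dotProduct, conj_apply_eq_dotProduct, hA, dotProduct_neg]
  have b1 : ∀ i, Q i 1 = P i 0 := fun i => by
    rw [hP, hQ, conj_apply_eq_dotProduct, conj_apply_eq_dotProduct, hB]
  have a2 : ∀ i, P i 2 = -(γ * P i 0) := fun i => by
    rw [hP, conj_apply_eq_dotProduct, conj_apply_eq_dotProduct, hC, dotProduct_neg,
      dotProduct_smul, smul_eq_mul]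
  have b2 : ∀ i, Q i 2 = γ * Q i 0 := fun i => by
    rw [hQ, conj_apply_eq_dotProduct, conj_apply_eq_dotProduct, hD, dotProduct_smul, smul_eq_mul]
  have htr : ∀ c s : ℝ, c ^ 2 + s ^ 2 = 1 → c * P.trace + s * Q.trace = 0 := fun c s hcs => by
    obtain ⟨W, hW, hL⟩ := hiso.exists_conj hsymm hcs
    have h1 := trace_orthogonal_conj hW L0d 1
    have h2 := trace_orthogonal_conj hO (c • L0d + s • L1) 1
    rw [← hL] at h1
    simp only [pow_one] at h1 h2
    rw [h1, trace_L0d_pow.1] at h2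
    simpa [hP, hQ, Matrix.mul_add, Matrix.add_mul] using h2
  have hP0 : P.trace = 0 := by simpa using htr 1 0 (by norm_num)
  have hQ0 : Q.trace = 0 := by simpa using htr 0 1 (by norm_num)
  have q0 : Q 0 0 = 0 := (mul_eq_zero.1 (by
    linear_combination (1 / 2) * (a1 2 - hPs 2 1 - a2 1 + γ * hPs 1 0 + γ * a1 0 - hQs 2 0 - b2 0) :
      γ * Q 0 0 = 0)).resolve_left hγ.ne'
  have p0 : P 0 0 = 0 := (mul_eq_zero.1 (by
    linear_combination (1 / 2) * (b1 2 - hQs 2 1 - b2 1 - γ * hQs 1 0 - γ * b1 0 + hPs 2 0 + a2 0) :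
      γ * P 0 0 = 0)).resolve_left hγ.ne'
  have P01 : P 0 1 = 0 := by rw [a1, q0, neg_zero]
  have Q01 : Q 0 1 = 0 := by rw [b1, p0]
  have P02 : P 0 2 = 0 := by rw [a2, p0, mul_zero, neg_zero]
  have Q02 : Q 0 2 = 0 := by rw [b2, q0, mul_zero]
  have P10 := (hPs 1 0).trans P01
  have Q10 := (hQs 1 0).trans Q01
  have P20 := (hPs 2 0).trans P02
  have Q20 := (hQs 2 0).trans Q02
  have P44 : P 4 4 = -P 3 3 := by
    have h := hP0
    simp only [Matrix.trace, Fin.sum_univ_five, diag_apply, p0, a1, a2, Q10, P20] at h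
    linarith
  have Q44 : Q 4 4 = -Q 3 3 := by
    have h := hQ0
    simp only [Matrix.trace, Fin.sum_univ_five, diag_apply, q0, b1, b2, P10, Q20] at h
    linarith
  refine ⟨O, ![P 0 3, P 0 4], ![Q 0 3, Q 0 4], P 3 3, P 3 4, Q 3 3, Q 3 4, hO, ?_, ?_⟩ <;> [rw [← hP]; rw [← hQ]]
  · ext i j
    fin_cases i <;> fin_cases j <;>
      simp [blockMat, p0, a1, a2, P44, q0, P10, Q10, P20, Q20, hPs 1 3, hPs 1 4, hPs 2 3, hPs 2 4, hPs 3 0, hPs 4 0,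
        hPs 4 3, hQs 3 0, hQs 4 0]
  · ext i j
    fin_cases i <;> fin_cases j <;>
      simp [blockMat, q0, b1, b2, Q44, p0, P10, Q10, P20, Q20, hQs 1 3, hQs 1 4, hQs 2 3, hQs 2 4, hQs 3 0, hQs 4 0,
        hQs 4 3, hPs 3 0, hPs 4 0]

/-- if `L(t) = cos(t)·L0 + sin(t)·L1` is isospectral and `rank L₊⁴ = 1`,
then there is a real orthogonal matrix `A` with `A·L(t)·A⁻¹ = cos(t)·L0 + sin(t)·M₁` for
all `t`; in this case `dim E = 3`. -/
theorem statement12 (L1 : Matrix (Fin 5) (Fin 5) ℝ) (hsymm : L1.IsSymm)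
    (hiso : Isospectral L1) (hrk : (LplusF L1 ^ 4).rank = 1) :
    (∃ A : Matrix (Fin 5) (Fin 5) ℝ, A * Aᵀ = 1 ∧
      ∀ t : ℝ, A * (Real.cos t • L0d + Real.sin t • L1) * A⁻¹ =
        Real.cos t • L0d + Real.sin t • M₁) ∧
    Module.finrank ℝ (Espan L1) = 3 := by
  have hne : LplusF L1 ^ 4 ≠ 0 := fun h => by simp [h] at hrk
  obtain ⟨γ, e₀, e₁, e₂, hγ, h00, h11, h22, h01, h02, h12, hA, hB, hC, hD⟩ :=
    hiso.exists_frame hsymm hne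
  refine ⟨?_, finrank_Espan_of_frame hsymm hiso hγ h00 h11 h22 h01 h02 h12 hA hB hC hD⟩
  obtain ⟨O, x, y, d, e, f, g, hO, hP, hQ⟩ :=
    hiso.exists_conj_blockMat hsymm hγ h00 h11 h22 h01 h02 h12 hA hB hC hD
  obtain ⟨rfl, rfl, rfl, rfl, hx, hy, hxy, rfl⟩ := block_solution (d := d) (e := e) (f := f)
      (g := g) (x := x) (y := y) hγ fun c s hcs B hB' => by
    obtain ⟨W, hW, hL⟩ := hiso.exists_conj hsymm hcs
    have hB'' : B = O * (c • L0d + s • L1) * Oᵀ := by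
      rw [Matrix.mul_add, Matrix.add_mul, Matrix.mul_smul, Matrix.mul_smul, Matrix.smul_mul,
        Matrix.smul_mul, hP, hQ, hB']
      ext i j
      fin_cases i <;> fin_cases j <;> simp [blockMat] <;> ring
    have htr : ∀ k, (B ^ k).trace = (L0d ^ k).trace := fun k => by
      rw [hB'', trace_orthogonal_conj hO, hL, trace_orthogonal_conj hW]
    simp only [htr]
    exact trace_L0d_pow.2
  obtain ⟨S, hS, hS0, hS1⟩ := exists_orthogonal_blockMat
  have hS' : Sᵀ * S = 1 := mul_eq_one_comm.1 hS
  have h3 : √3 * √3 = (3 : ℝ) := Real.mul_self_sqrt (by norm_num)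
  obtain ⟨R, hR, hRP, hRQ⟩ : ∃ R : Matrix (Fin 5) (Fin 5) ℝ, R * Rᵀ = 1 ∧
      R * (O * L0d * Oᵀ) * Rᵀ = S * L0d * Sᵀ ∧ R * (O * L1 * Oᵀ) * Rᵀ = S * M₁ * Sᵀ := by
    refine ⟨blockExt (√3 • x) (√3 • y), ?_, ?_, ?_⟩
    rotate_left
    · rw [hP, neg_zero, conj_blockMat, hS0]
      simp only [Pi.smul_apply, Pi.neg_apply, smul_eq_mul]
      congr 1 <;> ext i <;> fin_cases i <;> simp
      · linear_combination √3 * hx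
      · linear_combination √3 * hxy
      · linear_combination -√3 * hxy
      · linear_combination -√3 * hy
      · linear_combination -2 * √2 * √3 * hx
      · linear_combination -2 * √2 * √3 * hxy
    · rw [hQ, neg_zero, conj_blockMat, hS1]
      simp only [Pi.smul_apply, smul_eq_mul]
      congr 1 <;> ext i <;> fin_cases i <;> simp
      · linear_combination √3 * hxy
      · linear_combination √3 * hy
      · linear_combination √3 * hx
      · linear_combination √3 * hxy
      · linear_combination 2 * √2 * √3 * hxy
      · linear_combination 2 * √2 * √3 * hy
    · ext i j
      fin_cases i <;> fin_cases j <;> simp [blockExt, Matrix.mul_apply, Fin.sum_univ_five]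
      · linear_combination (x 0 ^ 2 + x 1 ^ 2) * h3 + 3 * hx
      · linear_combination √3 * √3 * hxy
      · linear_combination √3 * √3 * hxy
      · linear_combination (y 0 ^ 2 + y 1 ^ 2) * h3 + 3 * hy
  have hAA : (Sᵀ * R * O) * (Sᵀ * R * O)ᵀ = 1 := by
    calc (Sᵀ * R * O) * (Sᵀ * R * O)ᵀ = Sᵀ * (R * (O * Oᵀ) * Rᵀ) * S := by
          simp only [transpose_mul, transpose_transpose, Matrix.mul_assoc]
      _ = 1 := by rw [hO, Matrix.mul_one, hR, Matrix.mul_one, hS']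
  have hconj : ∀ X Y : Matrix (Fin 5) (Fin 5) ℝ, R * (O * X * Oᵀ) * Rᵀ = S * Y * Sᵀ →
      (Sᵀ * R * O) * X * (Sᵀ * R * O)ᵀ = Y := fun X Y h => by
    calc (Sᵀ * R * O) * X * (Sᵀ * R * O)ᵀ = Sᵀ * (R * (O * X * Oᵀ) * Rᵀ) * S := by
          simp only [transpose_mul, transpose_transpose, Matrix.mul_assoc]
      _ = (Sᵀ * S) * Y * (Sᵀ * S) := by rw [h]; simp only [Matrix.mul_assoc]
      _ = Y := by rw [hS', Matrix.one_mul, Matrix.mul_one]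
  refine ⟨Sᵀ * R * O, hAA, fun t => ?_⟩
  rw [Matrix.inv_eq_right_inv hAA, Matrix.mul_add, Matrix.add_mul, Matrix.mul_smul,
    Matrix.mul_smul, Matrix.smul_mul, Matrix.smul_mul, hconj _ _ hRP, hconj _ _ hRQ]

end
end

section
/- Let L1 be a real symmetric 5×5 matrix such that the family L(t) := cos(t)·L0 + sin(t)·L1 is isospectral, and suppose L_+^4 = 0 but L_+^3 ≠ 0. Then there exists a real orthogonal 5×5 matrix A such that A·L(t)·A^{−1} = cos(t)·L0 + sin(t)·M for all t ∈ ℝ, where M = (1/√3)·[[0,√3,0,0,0],[√3,0,0,2,0],[0,0,0,0,0],[0,2,0,0,√3],[0,0,0,√3,0]]. In this case dim E = 1. -/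
open Matrix Kronecker

noncomputable section

/-- The fifth normal form of `L1`. -/
def M₅ : Matrix (Fin 5) (Fin 5) ℝ :=
  (1 / Real.sqrt 3) •
    !![0, Real.sqrt 3, 0, 0, 0; Real.sqrt 3, 0, 0, 2, 0; 0, 0, 0, 0, 0;
       0, 2, 0, 0, Real.sqrt 3; 0, 0, 0, Real.sqrt 3, 0]

open Polynomial in
theorem Matrix.IsHermitian.exists_aeval_eq_smul_vecMulVec {n : Type*} [Fintype n] [DecidableEq n]
    {A : Matrix n n ℝ} (hA : A.IsHermitian) (p : ℝ[X]) (r : ℝ)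
    (hr : A.charpoly.roots.count r = 1)
    (hp : ∀ x ∈ A.charpoly.roots, x ≠ r → p.eval x = 0) :
    ∃ v : n → ℝ, v ⬝ᵥ v = 1 ∧ A *ᵥ v = r • v ∧ aeval A p = p.eval r • vecMulVec v v := by
  rw [hA.roots_charpoly_eq_eigenvalues] at hr hp
  have hr' := hr
  rw [Multiset.count_map, Multiset.card_eq_one] at hr'
  obtain ⟨i, hi⟩ := hr'
  have hmem : ∀ j, r = hA.eigenvalues j ↔ j = i := by
    intro j
    have : j ∈ Multiset.filter (fun a => r = (RCLike.ofReal ∘ hA.eigenvalues) a) Finset.univ.val ↔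
      j = i := by rw [hi]; simp
    simpa using this
  have hd : ∀ j, p.eval (hA.eigenvalues j) = if j = i then p.eval r else 0 := by
    intro j
    split_ifs with h
    · rw [← (hmem j).2 h]
    · refine hp _ ?_ ?_
      · simp
      · intro h'
        exact h ((hmem j).1 (by simpa using h'.symm))
  refine ⟨hA.eigenvectorBasis i, ?_, ?_, ?_⟩
  · have := hA.eigenvectorBasis.orthonormal.1 i
    have h2 := EuclideanSpace.real_norm_sq_eq (hA.eigenvectorBasis i)
    rw [this] at h2
    simp only [dotProduct, ← sq]
    linarith
  · rw [hA.mulVec_eigenvectorBasis, ← (hmem i).2 rfl]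
  · have h1 : aeval A p = Unitary.conjStarAlgAut ℝ _ hA.eigenvectorUnitary
        (diagonal fun j => p.eval (hA.eigenvalues j)) := by
      conv_lhs => rw [hA.spectral_theorem]
      have h3 : aeval (diagonal (RCLike.ofReal ∘ hA.eigenvalues) : Matrix n n ℝ) p =
          diagonal fun j => p.eval (hA.eigenvalues j) := by
        have := aeval_algHom_apply (Matrix.diagonalAlgHom (n := n) (α := ℝ) ℝ)
          (RCLike.ofReal ∘ hA.eigenvalues) p
        rw [Matrix.diagonalAlgHom_apply, Matrix.diagonalAlgHom_apply] at this
        rw [this]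
        congr 1
        ext j
        simp [aeval_fn_apply]
      rw [← h3]
      exact aeval_algHom_apply (Unitary.conjStarAlgAut ℝ (Matrix n n ℝ)
        hA.eigenvectorUnitary : Matrix n n ℝ ≃⋆ₐ[ℝ] Matrix n n ℝ) _ p
    rw [h1, Unitary.conjStarAlgAut_apply]
    ext a b
    simp [Matrix.mul_apply, diagonal_apply, hd, vecMulVec_apply, star_apply]
    ring

open Polynomial in
theorem Polynomial.exists_eq_mul_of_rank_one {n : Type*} [Fintype n] (q : n → n → ℂ[X]) (k : n)
    (hk : q k k ≠ 0) (hmul : ∀ i j, q k k * q i j = q k i * q k j) (m : ℕ)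
    (htr : ∑ i, q i i = X ^ m) (h0 : ∃ i j, (q i j).eval 0 ≠ 0) :
    ∃ u : n → ℂ[X], ∀ i j, q i j = u i * u j := by
  obtain ⟨d, hd⟩ := (IsPrincipalIdealRing.principal (Ideal.span (Set.range (q k)))).principal
  have hdm : d ∈ Ideal.span (Set.range (q k)) := by
    rw [hd]; exact Submodule.mem_span_singleton_self d
  obtain ⟨y, hy⟩ := Ideal.mem_span_range_iff_exists_fun.1 hdm
  have hdvd : ∀ i, ∃ c, q k i = d * c := by
    intro i
    have : q k i ∈ Ideal.span (Set.range (q k)) := Ideal.subset_span ⟨i, rfl⟩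
    rw [hd] at this
    exact Ideal.mem_span_singleton.1 this
  choose c hc using hdvd
  set g := ∑ i, ∑ j, y i * y j * q i j with hg
  have hdg : q k k * g = d * d := by
    have : d * d = (∑ i, y i * q k i) * (∑ j, y j * q k j) := by rw [hy]
    rw [this, Finset.sum_mul_sum, hg, Finset.mul_sum]
    refine Finset.sum_congr rfl fun i _ => ?_
    rw [Finset.mul_sum]
    refine Finset.sum_congr rfl fun j _ => ?_
    linear_combination (y i * y j) * hmul i j
  have hq : ∀ i j, q i j = g * (c i * c j) := by
    intro i j
    apply mul_left_cancel₀ hk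
    rw [hmul, hc i, hc j]
    linear_combination -(c i * c j) * hdg
  have hgd : g ∣ X ^ m := by
    rw [← htr]
    exact Finset.dvd_sum fun i _ => by rw [hq i i]; exact dvd_mul_right _ _
  obtain ⟨l, -, hl⟩ := (dvd_prime_pow prime_X m).1 hgd
  have hg0 : g.eval 0 ≠ 0 := by
    obtain ⟨i, j, hij⟩ := h0
    intro h
    apply hij
    rw [hq, eval_mul, h, zero_mul]
  have hl0 : l = 0 := by
    by_contra hne
    apply hg0
    obtain ⟨e, he⟩ := hl.dvd'
    rw [he]
    simp [hne]
  rw [hl0, pow_zero] at hl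
  obtain ⟨a, -, ha⟩ := isUnit_iff.1 (associated_one_iff_isUnit.1 hl)
  obtain ⟨b, hb⟩ := IsAlgClosed.exists_pow_nat_eq a (n := 2) (by norm_num)
  refine ⟨fun i => C b * c i, fun i j => ?_⟩
  rw [hq, ← ha, ← hb, C_pow]
  ring

open Polynomial in
theorem Polynomial.eq_of_eval_exp_mul_I_eq {p q : ℂ[X]}
    (h : ∀ t : ℝ, p.eval (Complex.exp (t * Complex.I)) = q.eval (Complex.exp (t * Complex.I))) :
    p = q := by
  apply Polynomial.eq_of_infinite_eval_eq
  have hinj : Set.InjOn (fun t : ℝ => Complex.exp (t * Complex.I)) (Set.Icc 0 1) := by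
    intro x hx y hy hxy
    have h2 := congrArg Complex.re hxy
    simp only [Complex.exp_ofReal_mul_I_re] at h2
    have hpi := Real.pi_gt_three
    exact Real.injOn_cos ⟨hx.1, by linarith [hx.2]⟩ ⟨hy.1, by linarith [hy.2]⟩ h2
  refine ((Set.Icc_infinite (zero_lt_one (α := ℝ))).image hinj).mono ?_
  rintro _ ⟨t, -, rfl⟩
  exact h t

open Polynomial in
theorem Matrix.exists_polynomial_of_pow_four_eq_zero {n : Type*} [Fintype n] [DecidableEq n]
    (a b : Matrix n n ℂ) (ha : a ^ 4 = 0) (hb : b ^ 4 = 0) (r s : ℂ) :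
    ∃ q : n → n → ℂ[X], (∀ i j, (q i j).natDegree ≤ 6) ∧
      (∀ i j, (q i j).coeff 6 = r * (a ^ 3) i j) ∧ (∀ i j, (q i j).eval 0 = r * (b ^ 3) i j) ∧
      ∀ z : ℂ, z • Matrix.of (fun i j => (q i j).eval z) = (z ^ 2 • a + b) ^ 4 +
        (r * z) • (z ^ 2 • a + b) ^ 3 - (s * z ^ 2) • (z ^ 2 • a + b) ^ 2 -
        (r * s * z ^ 3) • (z ^ 2 • a + b) := by
  obtain ⟨G, hG0, hG1, hG2, hG3, hG4, hG5, hG6⟩ : ∃ G : Fin 7 → Matrix n n ℂ,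
      G 0 = r • b ^ 3 ∧
      G 1 = (a * b * b * b + b * a * b * b + b * b * a * b + b * b * b * a) - s • b ^ 2 ∧
      G 2 = r • (a * b * b + b * a * b + b * b * a) - (r * s) • b ∧
      G 3 = (a * a * b * b + a * b * a * b + a * b * b * a + b * a * a * b + b * a * b * a
        + b * b * a * a) - s • (a * b + b * a) ∧
      G 4 = r • (a * a * b + a * b * a + b * a * a) - (r * s) • a ∧
      G 5 = (a * a * a * b + a * a * b * a + a * b * a * a + b * a * a * a) - s • a ^ 2 ∧
      G 6 = r • a ^ 3 :=
    ⟨![_, _, _, _, _, _, _], rfl, rfl, rfl, rfl, rfl, rfl, rfl⟩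
  have ha' : a * a * a * a = 0 := by rw [← ha]; noncomm_ring
  have hb' : b * b * b * b = 0 := by rw [← hb]; noncomm_ring
  refine ⟨fun i j => ∑ k : Fin 7, C (G k i j) * X ^ (k : ℕ), fun i j => ?_, fun i j => ?_,
    fun i j => ?_, fun z => ?_⟩
  · refine natDegree_sum_le_of_forall_le _ _ fun k _ => ?_
    exact (natDegree_C_mul_X_pow_le _ _).trans (by omega)
  · rw [finsetSum_coeff, Finset.sum_eq_single 6]
    · rw [coeff_C_mul_X_pow, hG6]
      simp
    · intro k _ hk
      rw [coeff_C_mul_X_pow, if_neg]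
      contrapose! hk
      exact Fin.ext hk.symm
    · simp
  · rw [eval_finsetSum, Finset.sum_eq_single 0]
    · simp [hG0]
    · intro k _ hk
      simp [Fin.val_ne_zero_iff.2 hk]
    · simp
  · have hev : Matrix.of (fun i j => (∑ k : Fin 7, C (G k i j) * X ^ (k : ℕ)).eval z) =
        G 0 + z • G 1 + z ^ 2 • G 2 + z ^ 3 • G 3 + z ^ 4 • G 4 + z ^ 5 • G 5 + z ^ 6 • G 6 := by
      ext i j
      simp only [Fin.sum_univ_seven, eval_add, eval_mul, eval_C, eval_pow, eval_X, of_apply,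
        Matrix.add_apply, Matrix.smul_apply, smul_eq_mul, Fin.val_zero, Fin.val_one, Fin.val_two,
        show ((3 : Fin 7) : ℕ) = 3 from rfl, show ((4 : Fin 7) : ℕ) = 4 from rfl,
        show ((5 : Fin 7) : ℕ) = 5 from rfl, show ((6 : Fin 7) : ℕ) = 6 from rfl]
      ring
    have h4 : (z ^ 2 • a + b) ^ 4 = z ^ 8 • (a * a * a * a) + b * b * b * b +
        (z ^ 2 • (a * b * b * b + b * a * b * b + b * b * a * b + b * b * b * a) +
        z ^ 4 • (a * a * b * b + a * b * a * b + a * b * b * a + b * a * a * b + b * a * b * a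
          + b * b * a * a) +
        z ^ 6 • (a * a * a * b + a * a * b * a + a * b * a * a + b * a * a * a)) := by
      simp only [pow_succ _ 3, pow_succ _ 2, pow_succ _ 1, pow_one, add_mul, mul_add, smul_mul_assoc,
        mul_smul_comm, smul_smul, smul_add, mul_assoc]
      module
    have h3 : (z ^ 2 • a + b) ^ 3 = b ^ 3 + z ^ 2 • (a * b * b + b * a * b + b * b * a) +
        z ^ 4 • (a * a * b + a * b * a + b * a * a) + z ^ 6 • a ^ 3 := by
      simp only [pow_succ _ 2, pow_succ _ 1, pow_one, add_mul, mul_add, smul_mul_assoc,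
        mul_smul_comm, smul_smul, smul_add, mul_assoc]
      module
    have h2 : (z ^ 2 • a + b) ^ 2 = b ^ 2 + z ^ 2 • (a * b + b * a) + z ^ 4 • a ^ 2 := by
      simp only [pow_succ _ 1, pow_one, add_mul, mul_add, smul_mul_assoc,
        mul_smul_comm, smul_smul, smul_add]
      module
    rw [hev, h4, h3, h2, ha', hb', hG0, hG1, hG2, hG3, hG4, hG5, hG6]
    module

theorem Matrix.sq_smul_add_eq_exp_smul {n : Type*} (D S : Matrix n n ℝ) (t : ℝ) :
    Complex.exp (t * Complex.I) ^ 2 •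
        ((1 / 2 : ℂ) • (D.map Complex.ofReal - Complex.I • S.map Complex.ofReal)) +
      (1 / 2 : ℂ) • (D.map Complex.ofReal + Complex.I • S.map Complex.ofReal) =
    Complex.exp (t * Complex.I) • (Real.cos t • D + Real.sin t • S).map Complex.ofReal := by
  ext i j
  have h := Complex.sin_sq_add_cos_sq (t : ℂ)
  simp only [Complex.exp_mul_I, Matrix.add_apply, Matrix.smul_apply, Matrix.map_apply,
    Matrix.sub_apply, smul_eq_mul, Complex.ofReal_add, Complex.ofReal_mul, Complex.ofReal_cos,
    Complex.ofReal_sin]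
  set c := Complex.cos t
  set s := Complex.sin t
  linear_combination (-((D i j : ℂ) + Complex.I * S i j) / 2) * h +
    (-(c * s * S i j) + D i j * s ^ 2 / 2 - s ^ 2 * Complex.I * S i j / 2) * Complex.I_sq

open Polynomial in
theorem Polynomial.four_mul_coeff_three {u : ℂ[X]} (hu : u.natDegree ≤ 3) :
    4 * u.coeff 3 = u.derivative.eval 1 + u.derivative.eval (-1) - u.eval 1 + u.eval (-1) := by
  have hd : u.derivative.natDegree < 4 := by
    have := natDegree_derivative_le u
    omega
  rw [eval_eq_sum_range' (p := u) (n := 4) (by omega) (1 : ℂ),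
    eval_eq_sum_range' (p := u) (n := 4) (by omega) (-1 : ℂ),
    eval_eq_sum_range' (n := 4) hd (1 : ℂ), eval_eq_sum_range' (n := 4) hd (-1 : ℂ)]
  have : u.coeff 4 = 0 := coeff_eq_zero_of_natDegree_lt (by omega)
  simp [Finset.sum_range_succ, coeff_derivative, this]
  ring

open Polynomial in
theorem Matrix.exists_leading_vector {n : Type*} [Fintype n] [DecidableEq n]
    (lam : n → ℝ) (S : Matrix n n ℝ) (hS : S.IsSymm) (a b : Matrix n n ℂ)
    (ha : a = (1 / 2 : ℂ) • ((diagonal lam).map Complex.ofReal - Complex.I • S.map Complex.ofReal))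
    (hb : b = (1 / 2 : ℂ) • ((diagonal lam).map Complex.ofReal + Complex.I • S.map Complex.ofReal))
    (ha4 : a ^ 4 = 0) (hb4 : b ^ 4 = 0) (hb3 : b ^ 3 ≠ 0) (r s d : ℝ) (hr : r ≠ 0) (hd : d ≠ 0)
    (hP : ∀ t : ℝ, ∃ v : n → ℝ, v ⬝ᵥ v = 1 ∧
      (Real.cos t • diagonal lam + Real.sin t • S) *ᵥ v = r • v ∧
      (Real.cos t • diagonal lam + Real.sin t • S) ^ 4 +
        r • (Real.cos t • diagonal lam + Real.sin t • S) ^ 3 -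
        s • (Real.cos t • diagonal lam + Real.sin t • S) ^ 2 -
        (r * s) • (Real.cos t • diagonal lam + Real.sin t • S) = d • vecMulVec v v)
    (k l : n) (hk : lam k = r) (hl : lam l = -r)
    (hk' : ∀ i, i ≠ k → lam i ≠ r) (hl' : ∀ i, i ≠ l → lam i ≠ -r) :
    S k k = 0 ∧ S l l = 0 ∧ ∃ (τ : ℂ) (x : n → ℂ), τ ^ 2 = -1 ∧
      (∀ i j, x i * x j = 16 * (r / d) * (a ^ 3) i j) ∧
      ∀ i, x i = (if i = k then 1 / 2 else 0) - (if i = l then τ / 2 else 0) -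
        Complex.I * S k i / (r - lam i) - Complex.I * τ * S l i / (r + lam i) := by
  obtain ⟨q, hq6, hq3, hq0, hqz⟩ := exists_polynomial_of_pow_four_eq_zero a b ha4 hb4 r s
  have hdC : (d : ℂ) ≠ 0 := Complex.ofReal_ne_zero.2 hd
  have hcirc : ∀ t : ℝ, Complex.exp (t * Complex.I) ^ 2 • a + b =
      Complex.exp (t * Complex.I) •
        (Real.cos t • diagonal lam + Real.sin t • S).map Complex.ofReal := by
    intro t
    rw [ha, hb]
    exact sq_smul_add_eq_exp_smul _ _ t
  set p : n → n → ℂ[X] := fun i j => C (d : ℂ)⁻¹ * q i j with hp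
  have hpv : ∀ t : ℝ, ∃ v : n → ℝ, v ⬝ᵥ v = 1 ∧
      (Real.cos t • diagonal lam + Real.sin t • S) *ᵥ v = r • v ∧
      ∀ i j, (p i j).eval (Complex.exp (t * Complex.I)) =
        Complex.exp (t * Complex.I) ^ 3 * (v i * v j) := by
    intro t
    obtain ⟨v, hv1, hv2, hv⟩ := hP t
    refine ⟨v, hv1, hv2, fun i j => ?_⟩
    have h1 := hqz (Complex.exp (t * Complex.I))
    rw [hcirc] at h1
    set z := Complex.exp (t * Complex.I) with hz
    set M := Real.cos t • diagonal lam + Real.sin t • S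
    have hz0 : z ≠ 0 := Complex.exp_ne_zero _
    have hpow : ∀ m, (M.map Complex.ofReal) ^ m = (M ^ m).map Complex.ofReal := fun m =>
      (Matrix.map_pow M Complex.ofRealHom m).symm
    rw [_root_.smul_pow, _root_.smul_pow, _root_.smul_pow, hpow, hpow, hpow] at h1
    have h2 := congrFun (congrFun h1 i) j
    have h3 := congrArg Complex.ofReal (congrFun (congrFun hv i) j)
    simp only [Matrix.add_apply, Matrix.sub_apply, Matrix.smul_apply, Matrix.map_apply, of_apply,
      smul_eq_mul, vecMulVec_apply, Complex.ofReal_add, Complex.ofReal_sub, Complex.ofReal_mul]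
      at h2 h3
    simp only [hp, eval_mul, eval_C]
    apply mul_left_cancel₀ (mul_ne_zero hz0 hdC)
    linear_combination h2 + z ^ 4 * h3 + z * (q i j).eval z * mul_inv_cancel₀ hdC
  have hmul : ∀ i j, p k k * p i j = p k i * p k j := by
    intro i j
    apply eq_of_eval_exp_mul_I_eq
    intro t
    obtain ⟨v, -, -, hv⟩ := hpv t
    simp only [eval_mul, hv]
    ring
  have htr : ∑ i, p i i = X ^ 3 := by
    apply eq_of_eval_exp_mul_I_eq
    intro t
    obtain ⟨v, hv1, -, hv⟩ := hpv t
    have : ∑ i, ((v i : ℂ) * v i) = 1 := by exact_mod_cast hv1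
    simp only [eval_finsetSum, eval_pow, eval_X, hv]
    rw [← Finset.mul_sum, this, mul_one]
  have hone : ∀ i j, (p i j).eval 1 = if i = k ∧ j = k then 1 else 0 := by
    obtain ⟨v, hv1, hv2, hv⟩ := hpv 0
    have h0 : ∀ i, i ≠ k → v i = 0 := by
      intro i hi
      have := congrFun hv2 i
      simp only [Real.cos_zero, Real.sin_zero, one_smul, zero_smul, add_zero, mulVec_diagonal,
        Pi.smul_apply, smul_eq_mul] at this
      have h : (lam i - r) * v i = 0 := by linear_combination this
      exact (mul_eq_zero.1 h).resolve_left (sub_ne_zero.2 (hk' i hi))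
    have h1 : v k * v k = 1 := by
      rw [← hv1, dotProduct, Finset.sum_eq_single k]
      · intro i _ hi
        rw [h0 i hi, mul_zero]
      · simp
    intro i j
    have := hv i j
    simp only [Complex.ofReal_zero, zero_mul, Complex.exp_zero, one_pow, one_mul] at this
    rw [this]
    split_ifs with h
    · rw [h.1, h.2]
      exact_mod_cast h1
    · rw [not_and_or] at h
      rcases h with h | h <;> simp [h0 _ h]
  have hneg : ∀ i j, (p i j).eval (-1) = if i = l ∧ j = l then -1 else 0 := by
    obtain ⟨v, hv1, hv2, hv⟩ := hpv Real.pi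
    have h0 : ∀ i, i ≠ l → v i = 0 := by
      intro i hi
      have := congrFun hv2 i
      simp only [Real.cos_pi, Real.sin_pi, neg_smul, one_smul, zero_smul, add_zero, neg_mulVec,
        mulVec_diagonal, Pi.smul_apply, Pi.neg_apply, smul_eq_mul] at this
      have h : (lam i - -r) * v i = 0 := by linear_combination -this
      exact (mul_eq_zero.1 h).resolve_left (sub_ne_zero.2 (hl' i hi))
    have h1 : v l * v l = 1 := by
      rw [← hv1, dotProduct, Finset.sum_eq_single l]
      · intro i _ hi
        rw [h0 i hi, mul_zero]
      · simp
    intro i j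
    have := hv i j
    rw [Complex.exp_pi_mul_I] at this
    rw [this]
    split_ifs with h
    · rw [h.1, h.2]
      have h2 : (v l : ℂ) * v l = 1 := by exact_mod_cast h1
      rw [h2]
      norm_num
    · rw [not_and_or] at h
      rcases h with h | h <;> simp [h0 _ h]
  have hpk : p k k ≠ 0 := by
    intro h
    have := hone k k
    simp [h] at this
  have h0 : ∃ i j, (p i j).eval 0 ≠ 0 := by
    by_contra! h
    apply hb3
    ext i j
    have := h i j
    simpa [hp, hq0, hd, hr] using this
  obtain ⟨u', hu'⟩ := exists_eq_mul_of_rank_one p k hpk hmul 3 htr h0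
  obtain ⟨u, hu, huk⟩ : ∃ u : n → ℂ[X], (∀ i j, p i j = u i * u j) ∧
      ∀ i, (u i).eval 1 = if i = k then 1 else 0 := by
    have hkk : (u' k).eval 1 * (u' k).eval 1 = 1 := by
      rw [← eval_mul, ← hu', hone]
      simp
    refine ⟨fun i => C ((u' k).eval 1) * u' i, fun i j => ?_, fun i => ?_⟩
    · have : C ((u' k).eval 1) * C ((u' k).eval 1) = 1 := by
        rw [← C_mul, hkk, C_1]
      rw [hu']
      linear_combination -(u' i * u' j) * this
    · rw [eval_mul, eval_C, ← eval_mul, ← hu', hone]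
      simp
  set τ : ℂ := (u l).eval (-1) with hτ
  have hτ2 : τ * τ = -1 := by
    rw [hτ, ← eval_mul, ← hu, hneg]
    simp
  have hτ0 : τ ≠ 0 := by
    rintro h
    simp [h] at hτ2
  have hul : ∀ i, (u i).eval (-1) = if i = l then τ else 0 := by
    intro i
    split_ifs with h
    · rw [h]
    · have : (u i).eval (-1) * τ = 0 := by
        rw [hτ, ← eval_mul, ← hu, hneg]
        simp [h]
      exact (mul_eq_zero.1 this).resolve_right hτ0
  have hdeg : ∀ i, (u i).natDegree ≤ 3 := by
    intro i
    have h1 : (p i i).natDegree ≤ 6 := (natDegree_C_mul_le _ _).trans (hq6 i i)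
    rw [hu, ← sq, natDegree_pow] at h1
    omega
  have huk0 : u k ≠ 0 := by
    intro h
    have := huk k
    simp [h] at this
  have heig : ∀ i, ∑ j, (C (a i j) * X ^ 2 + C (b i j)) * u j = C (r : ℂ) * X * u i := by
    intro i
    apply mul_right_cancel₀ huk0
    rw [Finset.sum_mul, mul_assoc, ← hu]
    simp only [mul_assoc, ← hu]
    apply eq_of_eval_exp_mul_I_eq
    intro t
    obtain ⟨v, -, hv2, hv⟩ := hpv t
    have h1 := hcirc t
    set z := Complex.exp (t * Complex.I)
    have h2 := congrArg Complex.ofReal (congrFun hv2 i)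
    simp only [mulVec, dotProduct, Complex.ofReal_sum, Complex.ofReal_mul, Pi.smul_apply,
      smul_eq_mul] at h2
    have h3 : ∀ j, a i j * z ^ 2 + b i j =
        z * ((Real.cos t • diagonal lam + Real.sin t • S) i j : ℝ) := by
      intro j
      have := congrFun (congrFun h1 i) j
      simp only [Matrix.add_apply, Matrix.smul_apply, Matrix.map_apply, smul_eq_mul] at this ⊢
      rw [← this]
      ring
    simp only [eval_finsetSum, eval_mul, eval_add, eval_C, eval_pow, eval_X, hv, h3]
    calc _ = z ^ 4 * v k *
            ∑ j, ((Real.cos t • diagonal lam + Real.sin t • S) i j : ℝ) * (v j : ℂ) := by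
          rw [Finset.mul_sum]
          exact Finset.sum_congr rfl fun j _ => by ring
      _ = _ := by
          rw [h2]
          ring
  have hab : ∀ i j, a i j + b i j = if i = j then (lam i : ℂ) else 0 := by
    intro i j
    rw [ha, hb]
    simp only [Matrix.smul_apply, Matrix.sub_apply, Matrix.add_apply, Matrix.map_apply,
      smul_eq_mul, diagonal_apply]
    split_ifs <;> push_cast <;> ring
  have haij : ∀ i j, a i j = ((if i = j then (lam i : ℂ) else 0) - Complex.I * S j i) / 2 := by
    intro i j
    rw [ha, hS.apply]
    simp only [Matrix.smul_apply, Matrix.sub_apply, Matrix.map_apply,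
      smul_eq_mul, diagonal_apply]
    split_ifs <;> push_cast <;> ring
  have hder : ∀ (c : ℂ) i, c ^ 2 = 1 → 2 * c * ∑ j, a i j * (u j).eval c +
      lam i * (u i).derivative.eval c = r * ((u i).eval c + c * (u i).derivative.eval c) := by
    intro c i hc
    have h1 := congrArg (fun f => (derivative f).eval c) (heig i)
    simp only [derivative_sum, derivative_mul, derivative_add, derivative_C, derivative_X_pow,
      derivative_X, eval_finsetSum, eval_mul, eval_add, eval_C, eval_pow, eval_X, hc, zero_mul,
      zero_add, add_zero, mul_one, hab, Finset.sum_add_distrib, ite_mul,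
      Finset.sum_ite_eq, Finset.mem_univ, if_true] at h1
    rw [Finset.mul_sum]
    convert h1 using 2
    · refine Finset.sum_congr rfl fun j _ => ?_
      norm_num
      ring
    · ring
  have hnorm : ∀ c : ℂ, 2 * ∑ i, (u i).eval c * (u i).derivative.eval c = 3 * c ^ 2 := by
    intro c
    have h1 := congrArg (fun f => (derivative f).eval c) htr
    simp only [hu, derivative_sum, derivative_mul, derivative_X_pow, eval_finsetSum, eval_mul,
      eval_add, eval_C, eval_pow, eval_X] at h1
    rw [Finset.mul_sum]
    convert h1 using 1
    · exact Finset.sum_congr rfl fun j _ => by ring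
    · norm_num
  have hD1 : ∀ i, (r - lam i) * (u i).derivative.eval 1 = -Complex.I * S k i := by
    intro i
    have h1 := hder 1 i (by norm_num)
    simp only [huk, mul_ite, mul_one, mul_zero, Finset.sum_ite_eq', Finset.mem_univ, if_true,
      haij] at h1
    by_cases h : i = k
    · subst h
      simp only [if_true, hk] at h1 ⊢
      linear_combination -h1
    · simp only [h, if_false] at h1 ⊢
      linear_combination -h1
  have hD2 : ∀ i, (r + lam i) * (u i).derivative.eval (-1) = -Complex.I * τ * S l i := by
    intro i
    have h1 := hder (-1) i (by norm_num)
    simp only [hul, mul_ite, mul_zero, Finset.sum_ite_eq', Finset.mem_univ, if_true,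
      haij] at h1
    by_cases h : i = l
    · subst h
      simp only [if_true, hl] at h1 ⊢
      push_cast at h1 ⊢
      linear_combination h1
    · simp only [h, if_false] at h1 ⊢
      linear_combination h1
  have hE1 : (u k).derivative.eval 1 = 3 / 2 := by
    have := hnorm 1
    simp only [huk, ite_mul, one_mul, zero_mul, Finset.sum_ite_eq', Finset.mem_univ, if_true]
      at this
    linear_combination this / 2
  have hE2 : (u l).derivative.eval (-1) = -3 / 2 * τ := by
    have := hnorm (-1)
    simp only [hul, ite_mul, zero_mul, Finset.sum_ite_eq', Finset.mem_univ, if_true]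
      at this
    linear_combination -τ * this / 2 + (u l).derivative.eval (-1) * hτ2
  have hSkk : S k k = 0 := by
    have := hD1 k
    rw [hk, sub_self, zero_mul] at this
    simpa using this.symm
  have hSll : S l l = 0 := by
    have := hD2 l
    rw [hl, Complex.ofReal_neg, add_neg_cancel, zero_mul] at this
    simpa [hτ0] using this.symm
  refine ⟨hSkk, hSll, τ, fun i => 4 * (u i).coeff 3, by rw [sq, hτ2], fun i j => ?_, fun i => ?_⟩
  · have h1 : (p i j).coeff 6 = (u i).coeff 3 * (u j).coeff 3 := by
      rw [hu]
      exact coeff_mul_add_eq_of_natDegree_le (hdeg i) (hdeg j)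
    have h2 : (p i j).coeff 6 = (d : ℂ)⁻¹ * (r * (a ^ 3) i j) := by
      rw [hp, coeff_C_mul, hq3]
    linear_combination -16 * h1 + 16 * h2
  · have hF1 : (u i).derivative.eval 1 =
        (if i = k then 3 / 2 else 0) - Complex.I * S k i / (r - lam i) := by
      split_ifs with h
      · rw [h, hE1, hSkk]
        simp
      · have h2 : (r : ℂ) - lam i ≠ 0 := by
          rw [← Complex.ofReal_sub]
          exact Complex.ofReal_ne_zero.2 (sub_ne_zero.2 (hk' i h).symm)
        field_simp
        linear_combination hD1 i
    have hF2 : (u i).derivative.eval (-1) =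
        (if i = l then -3 / 2 * τ else 0) - Complex.I * τ * S l i / (r + lam i) := by
      split_ifs with h
      · rw [h, hE2, hSll]
        simp
      · have h2 : (r : ℂ) + lam i ≠ 0 := by
          rw [← Complex.ofReal_add]
          refine Complex.ofReal_ne_zero.2 fun h3 => hl' i h ?_
          linarith
        field_simp
        linear_combination hD2 i
    beta_reduce
    rw [four_mul_coeff_three (hdeg i), hF1, hF2, huk, hul]
    split_ifs <;> ring

theorem sqrt_three_smul_family (L1 : Matrix (Fin 5) (Fin 5) ℝ) (t : ℝ) :
    Real.sqrt 3 • (Real.cos t • L0d + Real.sin t • L1) =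
      Real.cos t • diagonal ![3, 1, 0, -1, -3] + Real.sin t • (Real.sqrt 3 • L1) := by
  have hw : Real.sqrt 3 * Real.sqrt 3 = 3 := Real.mul_self_sqrt (by norm_num)
  have hw0 : Real.sqrt 3 ≠ 0 := by positivity
  have h : Real.sqrt 3 • L0d = diagonal ![3, 1, 0, -1, -3] := by
    rw [L0d, ← diagonal_smul]
    congr 1
    ext i
    fin_cases i <;> simp [hw, hw0]
  rw [← h]
  module

open Polynomial in
theorem Matrix.IsHermitian.exists_eigenvector_of_charpoly {L : Matrix (Fin 5) (Fin 5) ℝ}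
    (hL : L.IsHermitian) (hc : L.charpoly = X * (X ^ 2 - C 3) * (X ^ 2 - C (1 / 3 : ℝ)))
    (r s : ℝ) (hrs : r = 3 ∧ s = 1 ∨ r = 1 ∧ s = 9) :
    ∃ v : Fin 5 → ℝ, v ⬝ᵥ v = 1 ∧ (Real.sqrt 3 • L) *ᵥ v = r • v ∧
      (Real.sqrt 3 • L) ^ 4 + r • (Real.sqrt 3 • L) ^ 3 - s • (Real.sqrt 3 • L) ^ 2 -
        (r * s) • (Real.sqrt 3 • L) = (2 * r ^ 2 * (r ^ 2 - s)) • vecMulVec v v := by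
  set w := Real.sqrt 3 with hw
  have hw2 : w ^ 2 = 3 := Real.sq_sqrt (by norm_num)
  have hw0 : 0 < w := by positivity
  have hroots : L.charpoly.roots = {0, w, -w, w / 3, -w / 3} := by
    have h : L.charpoly = (Multiset.map (fun a => X - C a)
        ({0, w, -w, w / 3, -w / 3} : Multiset ℝ)).prod := by
      have h1 : (C w : ℝ[X]) * C w = C 3 := by rw [← C_mul, ← sq, hw2]
      have h2 : (C (w / 3) : ℝ[X]) * C (w / 3) = C (1 / 3) := by
        rw [← C_mul]
        congr 1
        linear_combination hw2 / 9
      rw [hc]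
      simp only [Multiset.insert_eq_cons, Multiset.map_cons, Multiset.map_singleton,
        Multiset.prod_cons, Multiset.prod_singleton, C_neg, C_0, neg_div]
      linear_combination X * (X ^ 2 - C (1 / 3)) * h1 + X * (X ^ 2 - C w * C w) * h2
    rw [h, roots_multiset_prod_X_sub_C]
  have hnd : ({0, w, -w, w / 3, -w / 3} : Multiset ℝ).Nodup := by
    simp only [Multiset.insert_eq_cons, Multiset.nodup_cons, Multiset.mem_cons,
      Multiset.mem_singleton, Multiset.nodup_singleton, not_or, and_true]
    refine ⟨⟨?_, ?_, ?_, ?_⟩, ⟨?_, ?_, ?_⟩, ⟨?_, ?_⟩, ?_⟩ <;> intro h <;> linarith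
  obtain ⟨v, hv1, hv2, hv3⟩ := hL.exists_aeval_eq_smul_vecMulVec
    (C (w ^ 4) * X ^ 4 + C (r * w ^ 3) * X ^ 3 - C (s * w ^ 2) * X ^ 2 - C (r * s * w) * X)
    (r * w / 3) (by
      rw [hroots]
      refine Multiset.count_eq_one_of_mem hnd ?_
      rcases hrs with ⟨h, -⟩ | ⟨h, -⟩ <;> simp [h]) (by
      rw [hroots]
      simp only [Multiset.insert_eq_cons, Multiset.mem_cons, Multiset.mem_singleton]
      have h4 : w ^ 4 = 9 := by rw [show w ^ 4 = (w ^ 2) ^ 2 by ring, hw2]; norm_num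
      have h3 : w ^ 3 = 3 * w := by rw [pow_succ, hw2]
      rintro x hx hxr
      simp only [eval_add, eval_sub, eval_mul, eval_C, eval_pow, eval_X]
      rcases hrs with ⟨rfl, rfl⟩ | ⟨rfl, rfl⟩ <;>
      rcases hx with rfl | rfl | rfl | rfl | rfl <;>
      first
        | exact absurd (by ring1) hxr
        | (simp only [h4, h3, hw2]; ring1)
        | (simp only [h4, h3, hw2]; ring_nf; simp only [h4, hw2]; ring1))
  refine ⟨v, hv1, ?_, ?_⟩
  · rw [smul_mulVec, hv2, smul_smul]
    congr 1
    linear_combination r / 3 * hw2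
  · have h : eval (r * w / 3) (C (w ^ 4) * X ^ 4 + C (r * w ^ 3) * X ^ 3 - C (s * w ^ 2) * X ^ 2
        - C (r * s * w) * X) = 2 * r ^ 2 * (r ^ 2 - s) := by
      simp only [eval_add, eval_sub, eval_mul, eval_C, eval_pow, eval_X]
      have h1 : w * (r * w / 3) = r := by linear_combination r / 3 * hw2
      calc _ = (w * (r * w / 3)) ^ 4 + r * (w * (r * w / 3)) ^ 3 - s * (w * (r * w / 3)) ^ 2
          - r * s * (w * (r * w / 3)) := by ring
        _ = _ := by rw [h1]; ring
    rw [h] at hv3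
    rw [← hv3]
    simp only [map_add, map_sub, map_mul, map_pow, aeval_X, aeval_C, Algebra.algebraMap_eq_smul_one,
      smul_mul_assoc, one_mul, one_pow, _root_.smul_pow, smul_smul]

theorem Complex.exists_eq_I_mul_of_sq_eq_neg_sq {z : ℂ} {w : ℝ} (h : z ^ 2 = -(w : ℂ) ^ 2) :
    ∃ ε : ℝ, ε ^ 2 = 1 ∧ z = Complex.I * (ε * w) := by
  have h1 : (z - Complex.I * w) * (z + Complex.I * w) = 0 := by
    linear_combination h - (w : ℂ) ^ 2 * Complex.I_sq
  rcases mul_eq_zero.1 h1 with h2 | h2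
  · exact ⟨1, by norm_num, by push_cast; linear_combination h2⟩
  · exact ⟨-1, by norm_num, by push_cast; linear_combination h2⟩

theorem exists_leading_vectors (S : Matrix (Fin 5) (Fin 5) ℝ) (hS : S.IsSymm)
    (a b : Matrix (Fin 5) (Fin 5) ℂ)
    (ha : a = (1 / 2 : ℂ) • ((diagonal ![3, 1, 0, -1, -3]).map Complex.ofReal -
      Complex.I • S.map Complex.ofReal))
    (hb : b = (1 / 2 : ℂ) • ((diagonal ![3, 1, 0, -1, -3]).map Complex.ofReal +
      Complex.I • S.map Complex.ofReal))
    (ha4 : a ^ 4 = 0) (hb4 : b ^ 4 = 0) (ha3 : a ^ 3 ≠ 0) (hb3 : b ^ 3 ≠ 0)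
    (hP : ∀ r s t : ℝ, (r = 3 ∧ s = 1 ∨ r = 1 ∧ s = 9) → ∃ v : Fin 5 → ℝ, v ⬝ᵥ v = 1 ∧
      (Real.cos t • diagonal ![3, 1, 0, -1, -3] + Real.sin t • S) *ᵥ v = r • v ∧
      (Real.cos t • diagonal ![3, 1, 0, -1, -3] + Real.sin t • S) ^ 4 +
        r • (Real.cos t • diagonal ![3, 1, 0, -1, -3] + Real.sin t • S) ^ 3 -
        s • (Real.cos t • diagonal ![3, 1, 0, -1, -3] + Real.sin t • S) ^ 2 -
        (r * s) • (Real.cos t • diagonal ![3, 1, 0, -1, -3] + Real.sin t • S) =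
          (2 * r ^ 2 * (r ^ 2 - s)) • vecMulVec v v) :
    S 0 0 = 0 ∧ S 1 1 = 0 ∧ S 3 3 = 0 ∧ S 4 4 = 0 ∧
    ∃ (ε ε' σ : ℝ) (x y : Fin 5 → ℂ), ε ^ 2 = 1 ∧ ε' ^ 2 = 1 ∧ σ ^ 2 = 1 ∧
      x ≠ 0 ∧ ∑ i, x i * x i = 0 ∧ a *ᵥ x = 0 ∧
      (∀ i, y i = Complex.I * (σ * Real.sqrt 3) * x i) ∧
      x = ![(1 / 2 - ε * S 0 4 / 6 : ℂ), -Complex.I * S 0 1 / 2 - ε * S 4 1 / 4,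
        -Complex.I * S 0 2 / 3 - ε * S 4 2 / 3, -Complex.I * S 0 3 / 4 - ε * S 4 3 / 2,
        -Complex.I * S 0 4 / 6 + Complex.I * ε / 2] ∧
      y = ![Complex.I * S 0 1 / 2 - ε' * S 0 3 / 4, 1 / 2 - ε' * S 1 3 / 2,
        -Complex.I * S 1 2 - ε' * S 3 2, -Complex.I * S 1 3 / 2 + Complex.I * ε' / 2,
        -Complex.I * S 4 1 / 4 + ε' * S 4 3 / 2] := by
  have hP1 := fun t => hP 3 1 t (Or.inl ⟨rfl, rfl⟩)
  have hP2 := fun t => hP 1 9 t (Or.inr ⟨rfl, rfl⟩)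
  rw [show (2 * 3 ^ 2 * (3 ^ 2 - 1) : ℝ) = 144 by norm_num] at hP1
  rw [show (2 * 1 ^ 2 * (1 ^ 2 - 9) : ℝ) = -16 by norm_num] at hP2
  obtain ⟨h00, h44, τ, x, hτ, hx, hxf⟩ := exists_leading_vector ![3, 1, 0, -1, -3] S hS a b ha hb
    ha4 hb4 hb3 3 1 144 (by norm_num) (by norm_num)
    hP1 0 4 rfl rfl
    (fun i hi => by fin_cases i <;> first | exact absurd rfl hi | norm_num)
    (fun i hi => by fin_cases i <;> first | exact absurd rfl hi | norm_num)
  obtain ⟨h11, h33, τ', y, hτ', hy, hyf⟩ := exists_leading_vector ![3, 1, 0, -1, -3] S hS a b ha hb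
    ha4 hb4 hb3 1 9 (-16) (by norm_num) (by norm_num)
    hP2 1 3 rfl rfl
    (fun i hi => by fin_cases i <;> first | exact absurd rfl hi | norm_num)
    (fun i hi => by fin_cases i <;> first | exact absurd rfl hi | norm_num)
  have hax : ∀ i j, (a ^ 3) i j = 3 * (x i * x j) := fun i j => by
    rw [hx]
    push_cast
    ring
  have hxy : ∀ i j, y i * y j = -3 * (x i * x j) := fun i j => by
    rw [hy, hx]
    push_cast
    ring
  have hx0 : ∃ j, x j ≠ 0 := by
    by_contra! h
    apply ha3
    ext i j
    simp [hax, h]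
  obtain ⟨j, hj⟩ := hx0
  have hw : (Real.sqrt 3 : ℂ) ^ 2 = 3 := by
    rw [← Complex.ofReal_pow, Real.sq_sqrt (by norm_num)]
    norm_num
  have hθ : (y j / x j) ^ 2 = -(Real.sqrt 3 : ℂ) ^ 2 := by
    rw [hw, div_pow, div_eq_iff (pow_ne_zero 2 hj), sq, sq]
    linear_combination hxy j j
  have hy0 : y j ≠ 0 := by
    intro h
    rw [h, zero_div, hw] at hθ
    norm_num at hθ
  have hyx : ∀ i, y i = y j / x j * x i := by
    intro i
    apply mul_right_cancel₀ hy0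
    have : y j / x j * x i * y j = (y j / x j) ^ 2 * (x i * x j) := by field_simp
    rw [this, hθ, hw, hxy]
  obtain ⟨σ, hσ, hσ'⟩ := Complex.exists_eq_I_mul_of_sq_eq_neg_sq hθ
  obtain ⟨ε, hε, hε'⟩ := Complex.exists_eq_I_mul_of_sq_eq_neg_sq (z := -τ) (w := 1)
    (by rw [neg_sq, hτ]; norm_num)
  obtain ⟨ε', hδ, hδ'⟩ := Complex.exists_eq_I_mul_of_sq_eq_neg_sq (z := -τ') (w := 1)
    (by rw [neg_sq, hτ']; norm_num)
  have hIτ : Complex.I * τ = ε := by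
    rw [Complex.ofReal_one] at hε'
    linear_combination -Complex.I * hε' - ε * Complex.I_sq
  have hIτ' : Complex.I * τ' = ε' := by
    rw [Complex.ofReal_one] at hδ'
    linear_combination -Complex.I * hδ' - ε' * Complex.I_sq
  have hτε : τ = -Complex.I * ε := by
    linear_combination -Complex.I * hIτ + τ * Complex.I_sq
  have hτε' : τ' = -Complex.I * ε' := by
    linear_combination -Complex.I * hIτ' + τ' * Complex.I_sq
  refine ⟨h00, h11, h33, h44, ε, ε', σ, x, y, hε, hδ, hσ, fun h => hj (congrFun h j), ?_, ?_,
    fun i => by rw [hyx, hσ'], ?_, ?_⟩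
  · have h6 : (a ^ 3 * a ^ 3) j j = 0 := by
      rw [← pow_add, show 3 + 3 = 4 + 2 from rfl, pow_add, ha4, zero_mul]
      rfl
    have h1 : (a ^ 3 * a ^ 3) j j = 9 * (x j * x j) * ∑ i, x i * x i := by
      rw [Matrix.mul_apply, Finset.mul_sum]
      refine Finset.sum_congr rfl fun i _ => ?_
      rw [hax, hax]
      ring
    rw [h6] at h1
    simpa [hj] using h1.symm
  · ext i
    have h1 : (a * a ^ 3) i j = 0 := by
      rw [← pow_succ', ha4]
      rfl
    have h2 : (a * a ^ 3) i j = 3 * (a *ᵥ x) i * x j := by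
      rw [Matrix.mul_apply, mulVec, dotProduct, Finset.mul_sum, Finset.sum_mul]
      refine Finset.sum_congr rfl fun i _ => ?_
      rw [hax]
      ring
    rw [h1] at h2
    simpa [hj] using h2.symm
  · ext i
    rw [hxf, hIτ, hτε]
    fin_cases i <;> simp [h00, h44, hS.apply 0 4] <;> norm_num <;> ring
  · ext i
    rw [hyf, hIτ', hτε']
    fin_cases i <;> simp [h11, h33, hS.apply 0 1, hS.apply 0 3, hS.apply 1 3, hS.apply 1 4,
      hS.apply 3 4] <;> norm_num <;> ring

theorem eq_of_leading_vectors (S : Matrix (Fin 5) (Fin 5) ℝ) (hS : S.IsSymm)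
    (a : Matrix (Fin 5) (Fin 5) ℂ)
    (ha : a = (1 / 2 : ℂ) • ((diagonal ![3, 1, 0, -1, -3]).map Complex.ofReal -
      Complex.I • S.map Complex.ofReal))
    (h00 : S 0 0 = 0) (h11 : S 1 1 = 0) (h22 : S 2 2 = 0) (h33 : S 3 3 = 0) (h44 : S 4 4 = 0)
    (ε ε' σ : ℝ) (x y : Fin 5 → ℂ) (hε : ε ^ 2 = 1) (hε' : ε' ^ 2 = 1) (hσ : σ ^ 2 = 1)
    (hx0 : x ≠ 0) (hxx : ∑ i, x i * x i = 0) (hax : a *ᵥ x = 0)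
    (hyx : ∀ i, y i = Complex.I * (σ * Real.sqrt 3) * x i)
    (hx : x = ![(1 / 2 - ε * S 0 4 / 6 : ℂ), -Complex.I * S 0 1 / 2 - ε * S 4 1 / 4,
      -Complex.I * S 0 2 / 3 - ε * S 4 2 / 3, -Complex.I * S 0 3 / 4 - ε * S 4 3 / 2,
      -Complex.I * S 0 4 / 6 + Complex.I * ε / 2])
    (hy : y = ![(Complex.I * S 0 1 / 2 - ε' * S 0 3 / 4 : ℂ), 1 / 2 - ε' * S 1 3 / 2,
      -Complex.I * S 1 2 - ε' * S 3 2, -Complex.I * S 1 3 / 2 + Complex.I * ε' / 2,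
      -Complex.I * S 4 1 / 4 + ε' * S 4 3 / 2]) :
    S = !![0, σ * Real.sqrt 3, 0, 0, 0;
      σ * Real.sqrt 3, 0, 0, -2 * ε', 0;
      0, 0, 0, 0, 0;
      0, -2 * ε', 0, 0, -(ε * ε' * (σ * Real.sqrt 3));
      0, 0, 0, -(ε * ε' * (σ * Real.sqrt 3)), 0] := by
  obtain ⟨s, hs⟩ : ∃ s, s = σ * Real.sqrt 3 := ⟨_, rfl⟩
  have hs2 : s ^ 2 = 3 := by
    rw [hs, mul_pow, hσ, Real.sq_sqrt (by norm_num)]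
    norm_num
  have hsC : (σ : ℂ) * (Real.sqrt 3 : ℂ) = s := by rw [hs, Complex.ofReal_mul]
  rw [hsC] at hyx
  rw [← hs]
  have e0 := hyx 0
  have e1 := hyx 1
  have e2 := hyx 2
  have e3 := hyx 3
  have e4 := hyx 4
  have hn := congrFun hax 0
  have hij : ∀ i j, a i j = (1 / 2 : ℂ) * ((if i = j then
      ((![3, 1, 0, -1, -3] : Fin 5 → ℝ) i : ℂ) else 0) - Complex.I * S i j) := by
    intro i j
    rw [ha]
    simp only [Matrix.smul_apply, Matrix.sub_apply, Matrix.map_apply, smul_eq_mul, diagonal_apply]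
    split_ifs <;> simp
  simp only [mulVec, dotProduct, Fin.sum_univ_five, hij] at hn
  rw [Fin.sum_univ_five] at hxx
  obtain ⟨c, hc⟩ : ∃ c, S 0 4 = c := ⟨_, rfl⟩
  obtain ⟨a1, ha1⟩ : ∃ c, S 0 1 = c := ⟨_, rfl⟩
  obtain ⟨a2, ha2⟩ : ∃ c, S 0 2 = c := ⟨_, rfl⟩
  obtain ⟨a3, ha3⟩ : ∃ c, S 0 3 = c := ⟨_, rfl⟩
  obtain ⟨f1, hf1⟩ : ∃ c, S 4 1 = c := ⟨_, rfl⟩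
  obtain ⟨f2, hf2⟩ : ∃ c, S 4 2 = c := ⟨_, rfl⟩
  obtain ⟨f3, hf3⟩ : ∃ c, S 4 3 = c := ⟨_, rfl⟩
  obtain ⟨b, hb⟩ : ∃ c, S 1 2 = c := ⟨_, rfl⟩
  obtain ⟨d, hd⟩ : ∃ c, S 1 3 = c := ⟨_, rfl⟩
  obtain ⟨h, hh⟩ : ∃ c, S 3 2 = c := ⟨_, rfl⟩
  simp only [hc, ha1, ha2, ha3, hf1, hf2, hf3, hb, hd, hh] at hx hy
  simp only [hx, h00, hc, ha1, ha2, ha3] at hn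
  simp only [hx, hy, Complex.ext_iff] at e0 e1 e2 e3 e4 hxx hn
  simp at e0 e1 e2 e3 e4 hxx hn
  have hs0 : s ≠ 0 := by
    rintro rfl
    norm_num at hs2
  obtain ⟨-, e0⟩ := e0
  obtain ⟨e1, -⟩ := e1
  obtain ⟨e2, e2'⟩ := e2
  obtain ⟨e3', e3⟩ := e3
  obtain ⟨e4, rfl⟩ := e4
  obtain rfl : a3 = 0 := e3'.resolve_left hs0
  have hf3' : f3 = ε' * (s * (c / 3 - ε)) := by linear_combination 2 * ε' * e4 - f3 * hε'
  have ha1' : a1 = s * (1 - ε * c / 3) := by linear_combination 2 * e0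
  have hd' : d = ε' * (1 - s * a1) := by linear_combination -2 * ε' * e1 - d * hε'
  have hfa : f2 * f2 = a2 * a2 := by
    have := hxx.1
    rw [hf3', ha1'] at this
    linear_combination 9 * this - (f2 ^ 2 - 9 * (1 / 4 - c ^ 2 / 36) -
      9 * s ^ 2 / 4 * (2 * ε * c / 3 - ε ^ 2 - 1)) * hε -
      9 * s ^ 2 / 4 * ε ^ 2 * (c / 3 - ε) ^ 2 * hε'
  have hε0 : ε ≠ 0 := by
    rintro rfl
    norm_num at hε
  have hf20 : f2 = 0 := by
    have h1 : ε * (a2 * f2) = 0 := by linear_combination 9 / 2 * hxx.2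
    have h2 : a2 * f2 = 0 := (mul_eq_zero.1 h1).resolve_left hε0
    have h3 : f2 ^ 4 = 0 := by linear_combination f2 ^ 2 * hfa + a2 * f2 * h2
    exact pow_eq_zero_iff (by norm_num) |>.1 h3
  subst hf20
  have ha20 : a2 = 0 := by simpa using hfa.symm
  subst ha20
  have hb0 : b = 0 := by linear_combination e2'
  have hh0 : h = 0 := by linear_combination ε' * e2 - h * hε'
  have hκ : (1 - ε * c / 3) * c = 0 := by
    have h1 := hn.1
    rw [ha1'] at h1
    linear_combination 2 * ε * h1 + ε * (1 - ε * c / 3) ^ 2 / 2 * hs2 -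
      (c - ε * c ^ 2 / 6) * hε
  have hc0 : c = 0 := by
    refine (mul_eq_zero.1 hκ).resolve_left fun h1 => hx0 ?_
    have hcε : c = 3 * ε := by linear_combination -3 * ε * h1 - c * hε
    rw [h1, mul_zero] at ha1'
    rw [hcε] at hf3'
    have hf30 : f3 = 0 := by linear_combination hf3'
    have h2 : (ε : ℂ) ^ 2 = 1 := by exact_mod_cast hε
    rw [hx, hcε, ha1', hf30]
    ext i
    fin_cases i <;> simp
    · linear_combination -h2 / 2
    · ring
  subst hc0
  have hd0 : d = -2 * ε' := by
    rw [hd', ha1']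
    linear_combination -ε' * hs2
  have hf30 : f3 = -(ε * ε' * s) := by linear_combination hf3'
  ext i j
  fin_cases i <;> fin_cases j <;>
    simp [h00, h11, h22, h33, h44, hc, ha1, ha2, ha3, hf1, hf2, hf3, hb, hd, hh, hb0, hh0,
      hS.apply 0 1, hS.apply 0 2, hS.apply 0 3, hS.apply 0 4, hS.apply 1 2, hS.apply 1 3,
      hS.apply 4 1, hS.apply 3 2, hS.apply 4 2, hS.apply 4 3, ha1', hd0, hf30]

theorem eq_zero_of_family_mulVec_eq_zero (ε ε' σ w t : ℝ) (hε : ε ^ 2 = 1) (hε' : ε' ^ 2 = 1)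
    (hσ : σ ^ 2 = 1) (hw : w ^ 2 = 3) (v : Fin 5 → ℝ)
    (hv : (Real.cos t • diagonal ![3, 1, 0, -1, -3] + Real.sin t • !![0, σ * w, 0, 0, 0;
      σ * w, 0, 0, -2 * ε', 0; 0, 0, 0, 0, 0; 0, -2 * ε', 0, 0, -(ε * ε' * (σ * w));
      0, 0, 0, -(ε * ε' * (σ * w)), 0]) *ᵥ v = 0) (i : Fin 5) (hi : i ≠ 2) : v i = 0 := by
  have hcs := Real.sin_sq_add_cos_sq t
  have e0 := congrFun hv 0
  have e1 := congrFun hv 1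
  have e3 := congrFun hv 3
  have e4 := congrFun hv 4
  simp [mulVec, dotProduct, Fin.sum_univ_five] at e0 e1 e3 e4
  set c := Real.cos t
  set s := Real.sin t
  have hσw : (σ * w) ^ 2 = 3 := by rw [mul_pow, hσ, hw, one_mul]
  have hεw : (ε * ε' * (σ * w)) ^ 2 = 3 := by rw [mul_pow, mul_pow, hε, hε', hσw]; norm_num
  have f1 : (c ^ 2 - s ^ 2) * v 1 - 2 * ε' * s * c * v 3 = 0 := by
    linear_combination c * e1 - s * (σ * w) / 3 * e0 + s ^ 2 * v 1 / 3 * hσw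
  have f3 : -(2 * ε' * s * c) * v 1 - (c ^ 2 - s ^ 2) * v 3 = 0 := by
    linear_combination c * e3 - s * (ε * ε' * (σ * w)) / 3 * e4 - s ^ 2 * v 3 / 3 * hεw
  have h1 : v 1 = 0 := by
    linear_combination (c ^ 2 - s ^ 2) * f1 - 2 * ε' * s * c * f3 -
      4 * s ^ 2 * c ^ 2 * v 1 * hε' - (s ^ 2 + c ^ 2 + 1) * v 1 * hcs
  have h3 : v 3 = 0 := by
    linear_combination -(2 * ε' * s * c) * f1 - (c ^ 2 - s ^ 2) * f3 -
      4 * s ^ 2 * c ^ 2 * v 3 * hε' - (s ^ 2 + c ^ 2 + 1) * v 3 * hcs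
  rw [h1, h3] at e1 e3
  rw [h1] at e0
  rw [h3] at e4
  have h0 : v 0 = 0 := by
    linear_combination c / 3 * e0 + s * (σ * w) / 3 * e1 - s ^ 2 * v 0 / 3 * hσw - v 0 * hcs
  have h4 : v 4 = 0 := by
    linear_combination -c / 3 * e4 - s * (ε * ε' * (σ * w)) / 3 * e3 - s ^ 2 * v 4 / 3 * hεw -
      v 4 * hcs
  fin_cases i
  · exact h0
  · exact h1
  · exact absurd rfl hi
  · exact h3
  · exact h4

theorem exists_normal_form (L1 : Matrix (Fin 5) (Fin 5) ℝ) (hsymm : L1.IsSymm)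
    (hiso : Isospectral L1) (h4 : LplusF L1 ^ 4 = 0) (h3 : LplusF L1 ^ 3 ≠ 0) :
    ∃ ε ε' σ : ℝ, ε ^ 2 = 1 ∧ ε' ^ 2 = 1 ∧ σ ^ 2 = 1 ∧
      Real.sqrt 3 • L1 = !![0, σ * Real.sqrt 3, 0, 0, 0;
        σ * Real.sqrt 3, 0, 0, -2 * ε', 0;
        0, 0, 0, 0, 0;
        0, -2 * ε', 0, 0, -(ε * ε' * (σ * Real.sqrt 3));
        0, 0, 0, -(ε * ε' * (σ * Real.sqrt 3)), 0] := by
  have hw0 : (Real.sqrt 3 : ℂ) ≠ 0 := Complex.ofReal_ne_zero.2 (by positivity)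
  have hΛ : Real.sqrt 3 • L0d = diagonal ![3, 1, 0, -1, -3] := by
    simpa using sqrt_three_smul_family L1 0
  have hS : (Real.sqrt 3 • L1).IsSymm := hsymm.smul _
  obtain ⟨a, ha⟩ : ∃ a, a = (Real.sqrt 3 : ℂ) • LplusF L1 := ⟨_, rfl⟩
  have ha' : a = (1 / 2 : ℂ) • ((diagonal ![3, 1, 0, -1, -3]).map Complex.ofReal -
      Complex.I • (Real.sqrt 3 • L1).map Complex.ofReal) := by
    rw [ha, LplusF, ← hΛ]
    ext i j
    simp only [Matrix.smul_apply, Matrix.sub_apply, Matrix.map_apply, smul_eq_mul,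
      Complex.ofReal_mul]
    ring
  obtain ⟨b, hb⟩ : ∃ b, b = a.map (starRingEnd ℂ) := ⟨_, rfl⟩
  have hb' : b = (1 / 2 : ℂ) • ((diagonal ![3, 1, 0, -1, -3]).map Complex.ofReal +
      Complex.I • (Real.sqrt 3 • L1).map Complex.ofReal) := by
    rw [hb, ha']
    ext i j
    simp only [Matrix.smul_apply, Matrix.sub_apply, Matrix.add_apply, Matrix.map_apply,
      smul_eq_mul, map_mul, map_sub, Complex.conj_I, Complex.conj_ofReal, map_div₀, map_one,
      Complex.conj_ofNat]
    ring
  have ha4 : a ^ 4 = 0 := by rw [ha, _root_.smul_pow, h4, smul_zero]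
  have ha3 : a ^ 3 ≠ 0 := by
    rw [ha, _root_.smul_pow]
    exact smul_ne_zero (pow_ne_zero 3 hw0) h3
  have hbpow : ∀ m, b ^ m = (a ^ m).map (starRingEnd ℂ) := fun m => by
    rw [hb, Matrix.map_pow]
  have hb4 : b ^ 4 = 0 := by
    rw [hbpow, ha4]
    ext
    simp
  have hb3 : b ^ 3 ≠ 0 := by
    intro h
    apply ha3
    ext i j
    have := congrFun (congrFun (hbpow 3) i) j
    rw [h] at this
    simpa using this.symm
  obtain ⟨h00, h11, h33, h44, ε, ε', σ, x, y, hε, hε', hσ, hx0, hxx, hax, hyx, hx, hy⟩ :=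
    exists_leading_vectors (Real.sqrt 3 • L1) hS a b ha' hb' ha4 hb4 ha3 hb3 fun r s t hrs => by
      rw [← sqrt_three_smul_family]
      refine IsHermitian.exists_eigenvector_of_charpoly ?_ (hiso t) r s hrs
      rw [IsHermitian, conjTranspose_eq_transpose_of_trivial]
      exact ((isSymm_diagonal _).smul _).add (hsymm.smul _)
  have h22 : (Real.sqrt 3 • L1) 2 2 = 0 := by
    have htr : a.trace = 0 := (isNilpotent_trace_of_isNilpotent ⟨4, ha4⟩).eq_zero
    have h1 : ∀ i, a i i = (1 / 2 : ℂ) * ((![3, 1, 0, -1, -3] : Fin 5 → ℝ) i -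
        Complex.I * ((Real.sqrt 3 • L1) i i : ℝ)) := by
      intro i
      rw [ha']
      simp
    simp only [trace, diag_apply, Fin.sum_univ_five, h1, h00, h11, h33, h44] at htr
    have h2 := congrArg Complex.im htr
    simpa using h2
  exact ⟨ε, ε', σ, hε, hε', hσ, eq_of_leading_vectors _ hS a ha' h00 h11 h22 h33 h44 ε ε' σ x y
    hε hε' hσ hx0 hxx hax hyx hx hy⟩

/-- if `L(t) = cos(t)·L0 + sin(t)·L1` is isospectral with `L₊⁴ = 0` and
`L₊³ ≠ 0`, then there is a real orthogonal matrix `A` with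
`A·L(t)·A⁻¹ = cos(t)·L0 + sin(t)·M₅` for all `t`; in this case `dim E = 1`. -/
theorem statement13 (L1 : Matrix (Fin 5) (Fin 5) ℝ) (hsymm : L1.IsSymm)
    (hiso : Isospectral L1) (h4 : LplusF L1 ^ 4 = 0) (h3 : LplusF L1 ^ 3 ≠ 0) :
    (∃ A : Matrix (Fin 5) (Fin 5) ℝ, A * Aᵀ = 1 ∧
      ∀ t : ℝ, A * (Real.cos t • L0d + Real.sin t • L1) * A⁻¹ =
        Real.cos t • L0d + Real.sin t • M₅) ∧
    Module.finrank ℝ (Espan L1) = 1 := by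
  obtain ⟨ε, ε', σ, hε, hε', hσ, hL⟩ := exists_normal_form L1 hsymm hiso h4 h3
  have hw : Real.sqrt 3 ^ 2 = 3 := Real.sq_sqrt (by norm_num)
  have hw0 : Real.sqrt 3 ≠ 0 := by positivity
  constructor
  · obtain ⟨A, hA⟩ : ∃ A : Matrix (Fin 5) (Fin 5) ℝ, A = diagonal ![1, σ, 1, -(σ * ε'), ε] :=
      ⟨_, rfl⟩
    have hAA : A * A = 1 := by
      rw [hA, diagonal_mul_diagonal, ← diagonal_one]
      congr 1
      ext i
      fin_cases i <;> simp
      · linear_combination hσ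
      · linear_combination ε' ^ 2 * hσ + hε'
      · linear_combination hε
    refine ⟨A, ?_, fun t => ?_⟩
    · rw [hA, diagonal_transpose, ← hA, hAA]
    · have h0 : A * L0d * A = L0d := by
        rw [show A * L0d = L0d * A by simp only [hA, L0d, diagonal_mul_diagonal, mul_comm],
          mul_assoc, hAA, mul_one]
      have h1 : A * L1 * A = M₅ := by
        have h2 : L1 = (1 / Real.sqrt 3) • Real.sqrt 3 • L1 := by
          rw [smul_smul, one_div_mul_cancel hw0, one_smul]
        rw [h2, hL, M₅, mul_smul_comm, smul_mul_assoc, hA]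
        congr 1
        ext i j
        rw [mul_diagonal, diagonal_mul]
        fin_cases i <;> fin_cases j <;> simp
        · linear_combination Real.sqrt 3 * hσ
        · linear_combination Real.sqrt 3 * hσ
        · linear_combination 2 * ε' ^ 2 * hσ + 2 * hε'
        · linear_combination 2 * ε' ^ 2 * hσ + 2 * hε'
        · linear_combination Real.sqrt 3 * (ε ^ 2 * ε' ^ 2 * hσ + ε ^ 2 * hε' + hε)
        · linear_combination Real.sqrt 3 * (ε ^ 2 * ε' ^ 2 * hσ + ε ^ 2 * hε' + hε)
      rw [inv_eq_right_inv hAA, mul_add, add_mul, mul_smul_comm, mul_smul_comm, smul_mul_assoc,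
        smul_mul_assoc, h0, h1]
  · have hker : ∀ t : ℝ, LinearMap.ker (Real.cos t • L0d + Real.sin t • L1).mulVecLin =
        Submodule.span ℝ {Pi.single 2 1} := by
      intro t
      have hiff : ∀ v, (Real.cos t • L0d + Real.sin t • L1) *ᵥ v = 0 ↔
          (Real.sqrt 3 • (Real.cos t • L0d + Real.sin t • L1)) *ᵥ v = 0 := by
        intro v
        rw [smul_mulVec, smul_eq_zero_iff_right hw0]
      apply le_antisymm
      · intro v hv
        rw [LinearMap.mem_ker, mulVecLin_apply, hiff, sqrt_three_smul_family, hL] at hv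
        rw [Submodule.mem_span_singleton]
        refine ⟨v 2, ?_⟩
        ext i
        by_cases hi : i = 2
        · simp [hi]
        · simp [hi, eq_zero_of_family_mulVec_eq_zero ε ε' σ _ t hε hε' hσ hw v hv i hi]
      · rw [Submodule.span_singleton_le_iff_mem, LinearMap.mem_ker, mulVecLin_apply, hiff,
          sqrt_three_smul_family, hL]
        ext i
        fin_cases i <;> simp
    rw [Espan, iSup_congr hker, iSup_const]
    exact finrank_span_singleton (by simp)

end
end
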